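/- arXiv:1301.5694 — 2 statements merged into one kernel-verified Lean document; each statement's English description precedes it below -/
import Mathlib

section
/- Let R be a commutative noetherian ring such that the character module of every Gorenstein injective R-module is Gorenstein flat. Then the class of Gorenstein injective complexes is enveloping in Ch(R): every unbounded chain complex of R-modules has a Gorenstein injective envelope. -/
open CategoryTheory CategoryTheory.Limits

universe u

section GenericDefs

variable {𝒜 : Type*} [Category 𝒜] [Abelian 𝒜]

/-- An object `G` of an abelian category is *Gorenstein injective* if it is a cycle object of
an exact (ℤ-indexed) complex of injective objects which stays exact under `Hom(I, -)` for
every injective object `I`. -/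
def IsGorensteinInjective (G : 𝒜) : Prop :=
  ∃ C : ChainComplex 𝒜 ℤ,
    (∀ n, Injective (C.X n)) ∧
    (∀ n, C.ExactAt n) ∧
    (∀ (I : 𝒜), Injective I → ∀ n,
      (((preadditiveCoyoneda.obj (Opposite.op I)).mapHomologicalComplex _).obj C).ExactAt n) ∧
    Nonempty (G ≅ kernel (C.d 0 (-1)))

/-- An object `G` is *Gorenstein projective* if it is a cycle object of an exact complex of
projectives which stays exact under `Hom(-, P)` for every projective `P`. -/
def IsGorensteinProjective (G : 𝒜) : Prop :=
  ∃ C : ChainComplex 𝒜 ℤ,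
    (∀ n, Projective (C.X n)) ∧
    (∀ n, C.ExactAt n) ∧
    (∀ (P : 𝒜), Projective P → ∀ n,
      (((preadditiveYoneda.obj P).mapHomologicalComplex _).obj C.op).ExactAt n) ∧
    Nonempty (G ≅ kernel (C.d 0 (-1)))

/-- `φ : G ⟶ X` is a `𝒞`-precover of `X`. -/
def IsPrecover (𝒞 : 𝒜 → Prop) {G X : 𝒜} (φ : G ⟶ X) : Prop :=
  𝒞 G ∧ ∀ (G' : 𝒜), 𝒞 G' → ∀ ψ : G' ⟶ X, ∃ h : G' ⟶ G, h ≫ φ = ψ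

/-- `φ : G ⟶ X` is a `𝒞`-cover of `X`. -/
def IsCover (𝒞 : 𝒜 → Prop) {G X : 𝒜} (φ : G ⟶ X) : Prop :=
  IsPrecover 𝒞 φ ∧ ∀ f : G ⟶ G, f ≫ φ = φ → IsIso f

/-- `φ : X ⟶ G` is a `𝒞`-preenvelope of `X`. -/
def IsPreenvelope (𝒞 : 𝒜 → Prop) {X G : 𝒜} (φ : X ⟶ G) : Prop :=
  𝒞 G ∧ ∀ (G' : 𝒜), 𝒞 G' → ∀ ψ : X ⟶ G', ∃ h : G ⟶ G', φ ≫ h = ψ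

/-- `φ : X ⟶ G` is a `𝒞`-envelope of `X`. -/
def IsEnvelope (𝒞 : 𝒜 → Prop) {X G : 𝒜} (φ : X ⟶ G) : Prop :=
  IsPreenvelope 𝒞 φ ∧ ∀ f : G ⟶ G, φ ≫ f = φ → IsIso f

/-- `Ext¹(X, Y) = 0`, expressed by the splitting of every extension of `X` by `Y`. -/
def Ext1Zero (X Y : 𝒜) : Prop :=
  ∀ (E : 𝒜) (i : Y ⟶ E) (p : E ⟶ X) (w : i ≫ p = 0),
    (ShortComplex.mk i p w).ShortExact → ∃ s : X ⟶ E, s ≫ p = 𝟙 X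

/-- `ExtSucZero n X Y` says `Ext^(n+1)(X, Y) = 0`; defined by dimension shifting along
short exact sequences `0 ⟶ Y ⟶ E ⟶ Y' ⟶ 0` with `E` injective. -/
def ExtSucZero : ℕ → 𝒜 → 𝒜 → Prop
  | 0, X, Y => Ext1Zero X Y
  | (n+1), X, Y => ∀ (E Y' : 𝒜) (i : Y ⟶ E) (p : E ⟶ Y') (w : i ≫ p = 0),
      (ShortComplex.mk i p w).ShortExact → Injective E → ExtSucZero n X Y'

/-- A special `𝒞`-precover: an epimorphism `φ : G ⟶ X` with `G ∈ 𝒞` arising in a short exact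
sequence `0 ⟶ A ⟶ G ⟶ X ⟶ 0` with `Ext¹(G', A) = 0` for all `G' ∈ 𝒞`. -/
def IsSpecialPrecover (𝒞 : 𝒜 → Prop) {G X : 𝒜} (φ : G ⟶ X) : Prop :=
  IsPrecover 𝒞 φ ∧ ∃ (A : 𝒜) (i : A ⟶ G) (w : i ≫ φ = 0),
    (ShortComplex.mk i φ w).ShortExact ∧ ∀ (G' : 𝒜), 𝒞 G' → Ext1Zero G' A

/-- The left `Ext¹`-orthogonal class `⊥𝒞` of a class of objects `𝒞`. -/
def leftOrthogonal {𝒜 : Type*} [Category 𝒜] [Abelian 𝒜] (𝒞 : 𝒜 → Prop) (X : 𝒜) : Prop :=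
  ∀ Y : 𝒜, 𝒞 Y → Ext1Zero X Y

/-- The right `Ext¹`-orthogonal class `𝒞⊥` of a class of objects `𝒞`. -/
def rightOrthogonal {𝒜 : Type*} [Category 𝒜] [Abelian 𝒜] (𝒞 : 𝒜 → Prop) (Y : 𝒜) : Prop :=
  ∀ X : 𝒜, 𝒞 X → Ext1Zero X Y

end GenericDefs

section GorensteinFlat

variable (R : Type u) [CommRing R]

/-- An `R`-module `N` is *Gorenstein flat* if it is a cycle module of an exact complex of flat
modules which stays exact under `I ⊗ -` for every injective module `I`. -/
def IsGorensteinFlat (N : ModuleCat.{u} R) : Prop :=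
  ∃ C : ChainComplex (ModuleCat.{u} R) ℤ,
    (∀ n, Module.Flat R (C.X n)) ∧
    (∀ n, C.ExactAt n) ∧
    (∀ (I : ModuleCat.{u} R), Injective I → ∀ n,
      (((MonoidalCategory.tensorLeft I).mapHomologicalComplex _).obj C).ExactAt n) ∧
    Nonempty (N ≅ kernel (C.d 0 (-1)))

end GorensteinFlat

universe v w

section Zorn
variable {𝒜 : Type u} [Category.{v} 𝒜] [Abelian 𝒜] [IsGrothendieckAbelian.{v} 𝒜]

/-- The members of a monotone directed family of subobjects form a filtered diagram, whose
colimit is the supremum of the family. -/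
lemma exists_isColimit_of_monotone {E : 𝒜} {J : Type v} [Preorder J] [IsDirectedOrder J]
    [Nonempty J] (g : J → Subobject E) (hg : Monotone g) :
    ∃ (F : J ⥤ 𝒜) (s : Cocone F) (_ : IsColimit s)
      (e : s.pt ≅ ((⨆ j, g j : Subobject E) : 𝒜)),
      ∀ j, ∃ i : F.obj j ≅ (g j : 𝒜),
        s.ι.app j ≫ e.hom ≫ (⨆ j, g j).arrow = i.hom ≫ (g j).arrow := by
  let F : J ⥤ MonoOver E :=
    { obj j := MonoOver.mk (g j).arrow
      map {j j'} f := MonoOver.homMk (Subobject.ofLE _ _ (hg (leOfHom f))) }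
  let t := colimit.cocone (F ⋙ MonoOver.forget _ ⋙ Over.forget _)
  let f : t.pt ⟶ E := colimit.desc (F ⋙ MonoOver.forget _ ⋙ Over.forget _)
    { pt := E
      ι :=
        { app j := (F.obj j).obj.hom
          naturality {j j'} g := by simp [MonoOver.forget] } }
  have hf : ∀ j, t.ι.app j ≫ f = (F.obj j).obj.hom := fun j => colimit.ι_desc _ j
  have hmono := IsGrothendieckAbelian.mono_of_isColimit_monoOver F (colimit.isColimit _) f hf
  have hsup : Subobject.mk f = ⨆ j, g j := by
    refine (IsGrothendieckAbelian.subobjectMk_of_isColimit_eq_iSup F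
      (colimit.isColimit _) f hf).trans ?_
    exact iSup_congr fun j => Subobject.mk_arrow (g j)
  refine ⟨F ⋙ MonoOver.forget _ ⋙ Over.forget _, t,
    colimit.isColimit _, (Subobject.underlyingIso f).symm ≪≫ Subobject.isoOfEq _ _ hsup,
    fun j => ⟨Iso.refl _, ?_⟩⟩
  have := hf j
  simp only [Iso.trans_hom, Iso.symm_hom, Subobject.isoOfEq_hom, Category.assoc,
    Subobject.ofLE_arrow, Subobject.underlyingIso_arrow, Iso.refl_hom]
  exact this.trans (Category.id_comp _).symm

/-- The members of a nonempty chain of subobjects form a filtered diagram, whose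
colimit is the supremum of the chain. -/
lemma exists_isColimit_of_isChain {E : 𝒜} {c : Set (Subobject E)} (hc : IsChain (· ≤ ·) c)
    (hne : c.Nonempty) :
    ∃ (J : Type v) (_ : SmallCategory J) (_ : IsFiltered J) (F : J ⥤ 𝒜)
      (s : Cocone F) (_ : IsColimit s) (e : s.pt ≅ ((sSup c : Subobject E) : 𝒜)),
      ∀ j, ∃ S ∈ c, ∃ i : F.obj j ≅ (S : 𝒜),
        s.ι.app j ≫ e.hom ≫ (sSup c).arrow = i.hom ≫ S.arrow := by
  obtain ⟨J, ⟨eJ⟩⟩ : ∃ J : Type v, Nonempty (J ≃ c) := ⟨_, ⟨(equivShrink.{v} c).symm⟩⟩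
  let _ : Preorder J := Preorder.lift (fun j => (eJ j : Subobject E))
  have : Nonempty J := ⟨eJ.symm ⟨_, hne.some_mem⟩⟩
  have : IsDirectedOrder J := ⟨fun a b => by
    rcases hc.total (eJ a).2 (eJ b).2 with h | h
    · exact ⟨b, h, le_refl _⟩
    · exact ⟨a, le_refl _, h⟩⟩
  obtain ⟨F, s, hs, e, h⟩ := exists_isColimit_of_monotone (fun j => (eJ j : Subobject E))
    (fun _ _ h => h)
  have hsup : (⨆ j, (eJ j : Subobject E)) = sSup c := by
    rw [sSup_eq_iSup', eJ.iSup_comp (g := fun S : c => (S : Subobject E))]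
  refine ⟨J, inferInstance, inferInstance, F, s, hs, e ≪≫ Subobject.isoOfEq _ _ hsup,
    fun j => ?_⟩
  obtain ⟨i, hi⟩ := h j
  exact ⟨_, (eJ j).2, i, by simpa using hi⟩

lemma mono_sSup_arrow_comp {E Z : 𝒜} {c : Set (Subobject E)} (hc : IsChain (· ≤ ·) c)
    (hne : c.Nonempty) (r : E ⟶ Z) (h : ∀ S ∈ c, Mono (S.arrow ≫ r)) :
    Mono ((sSup c).arrow ≫ r) := by
  obtain ⟨J, _, _, F, s, hs, e, hF⟩ := exists_isColimit_of_isChain hc hne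
  have := IsFiltered.isConnected J
  have : Mono (e.hom ≫ (sSup c).arrow ≫ r) := by
    let α : F ⟶ (Functor.const J).obj Z :=
      { app j := s.ι.app j ≫ e.hom ≫ (sSup c).arrow ≫ r
        naturality {i j} g := by
          have := s.w g
          simp [reassoc_of% this] }
    have hα : ∀ j, Mono (α.app j) := fun j => by
      obtain ⟨S, hS, i, hi⟩ := hF j
      have : α.app j = i.hom ≫ S.arrow ≫ r := by
        simp only [← Category.assoc] at hi ⊢
        simp [α, ← hi]
      have := h S hS
      rw [‹α.app j = _›]
      infer_instance
    have := NatTrans.mono_of_mono_app α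
    exact colim.map_mono' α hs (isColimitConstCocone J Z) _ fun j => (Category.comp_id _).symm
  have h2 : (sSup c).arrow ≫ r = e.inv ≫ (e.hom ≫ (sSup c).arrow ≫ r) := by simp
  rw [h2]
  infer_instance

/-- Zorn's lemma for subobjects on which a given morphism restricts to a monomorphism. -/
lemma exists_maximal_subobject {E Z : 𝒜} (r : E ⟶ Z) (A : Subobject E)
    (p : Subobject E → Prop)
    (hA : p A) (hrA : Mono (A.arrow ≫ r))
    (hp : ∀ c : Set (Subobject E), IsChain (· ≤ ·) c → c.Nonempty → (∀ S ∈ c, p S) →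
      p (sSup c)) :
    ∃ M : Subobject E, A ≤ M ∧ Maximal (fun S => p S ∧ Mono (S.arrow ≫ r)) M := by
  apply zorn_le_nonempty₀ {S : Subobject E | p S ∧ Mono (S.arrow ≫ r)} _ A ⟨hA, hrA⟩
  intro c hcs hc y hy
  exact ⟨sSup c, ⟨hp c hc ⟨y, hy⟩ fun S hS => (hcs hS).1,
    mono_sSup_arrow_comp hc ⟨y, hy⟩ r fun S hS => (hcs hS).2⟩, fun S hS => le_sSup hS⟩
end Zorn

lemma mono_mk_arrow_comp {𝒞 : Type u} [Category.{v} 𝒞] {M E Q : 𝒞} (m : M ⟶ E) [Mono m] (q : E ⟶ Q)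
    (h : Mono (m ≫ q)) :
    Mono ((Subobject.mk m).arrow ≫ q) := by
  rw [← Subobject.underlyingIso_hom_comp_eq_mk, Category.assoc]
  infer_instance

section Essential
variable {𝒜 : Type u} [Category.{v} 𝒜] [Abelian 𝒜]

lemma mono_biprod_desc {A B E : 𝒜} (a : A ⟶ E) (b : B ⟶ E) [Mono b] (ρ : E ⟶ A)
    (ha : a ≫ ρ = 𝟙 A) (hb : b ≫ ρ = 0) : Mono (biprod.desc a b) := by
  refine Preadditive.mono_of_cancel_zero _ fun x hx => ?_
  have h1 : x ≫ biprod.fst = 0 := by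
    have h2 : biprod.fst = biprod.desc a b ≫ ρ := by ext <;> simp [ha, hb]
    rw [h2, reassoc_of% hx, zero_comp]
  have h2 : x ≫ biprod.snd = 0 := by
    rw [biprod.desc_eq] at hx
    rw [← cancel_mono b, zero_comp]
    simpa [reassoc_of% h1] using hx
  exact biprod.hom_ext _ _ (by simpa using h1) (by simpa using h2)

lemma exists_lift_of_comp_cokernel_eq_zero {A E W : 𝒜} (a : A ⟶ E) [Mono a] (x : W ⟶ E)
    (h : x ≫ cokernel.π a = 0) : ∃ y : W ⟶ A, y ≫ a = x :=
  ⟨Abelian.monoLift a x h, Abelian.monoLift_comp a x h⟩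

lemma mono_kernel_ι_comp_cokernel_π {A E Q : 𝒜} (a : A ⟶ E) (q : E ⟶ Q) (h : Mono (a ≫ q)) :
    Mono (kernel.ι q ≫ cokernel.π a) := by
  have := mono_of_mono a q
  refine Preadditive.mono_of_cancel_zero _ fun x hx => ?_
  obtain ⟨y, hy⟩ := exists_lift_of_comp_cokernel_eq_zero a (x ≫ kernel.ι q) (by simpa using hx)
  have hy0 : y = 0 := by
    rw [← cancel_mono (a ≫ q), ← Category.assoc, hy]; simp
  rw [← cancel_mono (kernel.ι q), ← hy, hy0]; simp

lemma mono_comp_cokernel_π_symm {A B E : 𝒜} (a : A ⟶ E) (b : B ⟶ E) [Mono b]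
    [Mono a] (h : Mono (b ≫ cokernel.π a)) : Mono (a ≫ cokernel.π b) := by
  refine Preadditive.mono_of_cancel_zero _ fun x hx => ?_
  obtain ⟨y, hy⟩ := exists_lift_of_comp_cokernel_eq_zero b (x ≫ a) (by simpa using hx)
  have hy0 : y = 0 := by
    rw [← cancel_mono (b ≫ cokernel.π a), ← Category.assoc, hy]; simp
  rw [← cancel_mono a, ← hy, hy0]; simp

variable [IsGrothendieckAbelian.{v} 𝒜]

/-- Among the quotients of `Q` into which `N` still embeds, a smallest one is essential
over `N`. -/
lemma exists_essential_quotient {N E Q : 𝒜} (n : N ⟶ E) (q : E ⟶ Q) (h : Mono (n ≫ q)) :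
    ∃ (Q' : 𝒜) (q' : E ⟶ Q'), kernel.ι q ≫ q' = 0 ∧ Mono (n ≫ q') ∧
      ∀ {Z : 𝒜} (g : Q' ⟶ Z), Mono (n ≫ q' ≫ g) → Mono g := by
  have hn := mono_of_mono n q
  obtain ⟨L, hL, hmax⟩ := exists_maximal_subobject (cokernel.π n) (Subobject.mk (kernel.ι q))
    (fun _ => True) trivial (mono_mk_arrow_comp _ _
      (mono_kernel_ι_comp_cokernel_π n q h)) (fun _ _ _ _ => trivial)
  have hLm := hmax.1.2
  refine ⟨cokernel L.arrow, cokernel.π L.arrow, ?_, mono_comp_cokernel_π_symm n L.arrow hLm, ?_⟩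
  · rw [← Subobject.ofMkLE_arrow hL, Category.assoc, cokernel.condition, comp_zero]
  · intro Z g hg
    have h1 := mono_kernel_ι_comp_cokernel_π n (cokernel.π L.arrow ≫ g) hg
    have h2 : L ≤ Subobject.mk (kernel.ι (cokernel.π L.arrow ≫ g)) :=
      Subobject.le_mk_of_comm (kernel.lift _ L.arrow (by simp)) (by simp)
    have h3 := hmax.2 ⟨trivial, mono_mk_arrow_comp _ _ ‹_›⟩ h2
    have h4 : kernel.ι (cokernel.π L.arrow ≫ g) ≫ cokernel.π L.arrow = 0 := by
      rw [← Subobject.ofMkLE_arrow h3, Category.assoc, cokernel.condition, comp_zero]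
    refine Preadditive.mono_of_cancel_zero _ fun x hx => ?_
    obtain ⟨W, π, _, y, hy⟩ := surjective_up_to_refinements_of_epi (cokernel.π L.arrow) x
    rw [← cancel_epi π, hy]
    have : y = kernel.lift (cokernel.π L.arrow ≫ g) y (by rw [← reassoc_of% hy, hx]; simp) ≫
      kernel.ι _ := by simp
    rw [this, Category.assoc, h4]; simp

/-- Inside an injective object, a subobject disjoint from the kernel of `q` is contained in
an injective subobject with the same property. -/
lemma exists_injective_of_mono_comp {N E Q : 𝒜} [Injective E] (n : N ⟶ E) (q : E ⟶ Q)
    (h : Mono (n ≫ q)) :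
    ∃ (M : Subobject E) (t : N ⟶ M), Injective (M : 𝒜) ∧ t ≫ M.arrow = n ∧
      Mono (M.arrow ≫ q) := by
  obtain ⟨Q', q', hqq', hnq', hess⟩ := exists_essential_quotient n q h
  have hn := mono_of_mono n q
  obtain ⟨M, hM, hmax⟩ := exists_maximal_subobject q' (Subobject.mk n)
    (fun _ => True) trivial (mono_mk_arrow_comp _ _ ‹_›) (fun _ _ _ _ => trivial)
  have hMm := hmax.1.2
  let t := Subobject.ofMkLE _ _ hM
  have ht : t ≫ M.arrow = n := Subobject.ofMkLE_arrow hM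
  let k : Q' ⟶ E := Injective.factorThru M.arrow (M.arrow ≫ q')
  have hk : M.arrow ≫ q' ≫ k = M.arrow := by
    rw [← Category.assoc]; exact Injective.comp_factorThru _ _
  have hnk : n ≫ q' ≫ k = n := by rw [← ht, Category.assoc, hk]
  have hkm : Mono k := hess k (by rw [hnk]; infer_instance)
  have hkq : Mono (k ≫ q') := hess _ (by rw [reassoc_of% hnk]; infer_instance)
  have h3 := hmax.2 (y := Subobject.mk k) ⟨trivial, mono_mk_arrow_comp _ _ ‹_›⟩
    (Subobject.le_mk_of_comm (M.arrow ≫ q') (by simpa using hk))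
  refine ⟨M, t, ?_, ht, ?_⟩
  · refine Retract.injective (Y := E) ⟨M.arrow, q' ≫ Subobject.ofMkLE _ _ h3, ?_⟩
    rw [← cancel_mono M.arrow]
    simp [hk]
  · refine Preadditive.mono_of_cancel_zero _ fun x hx => ?_
    rw [← cancel_mono (M.arrow ≫ q'), zero_comp]
    have : x ≫ M.arrow = kernel.lift q (x ≫ M.arrow) (by simpa using hx) ≫ kernel.ι q := by simp
    rw [reassoc_of% this, hqq', comp_zero]

end Essential

/-- The union of a nonempty chain of injective subobjects is injective. -/
def HasInjectiveChainUnions (𝒜 : Type u) [Category.{v} 𝒜] [Abelian 𝒜]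
    [IsGrothendieckAbelian.{v} 𝒜] : Prop :=
  ∀ (E : 𝒜) (c : Set (Subobject E)), IsChain (· ≤ ·) c → c.Nonempty →
    (∀ S ∈ c, Injective (S : 𝒜)) → Injective ((sSup c : Subobject E) : 𝒜)

section InjectiveSubobjects
variable {𝒜 : Type u} [Category.{v} 𝒜] [Abelian 𝒜] [IsGrothendieckAbelian.{v} 𝒜]

lemma exists_maximal_injective_subobject (hI : HasInjectiveChainUnions 𝒜) {G Z : 𝒜} (r : G ⟶ Z) :
    ∃ T : Subobject G, Injective (T : 𝒜) ∧ Mono (T.arrow ≫ r) ∧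
      ∀ {E : 𝒜} (j : E ⟶ G), Injective E → Mono (biprod.desc T.arrow j ≫ r) → IsZero E := by
  have h0 : IsZero ((⊥ : Subobject G) : 𝒜) :=
    (isZero_zero 𝒜).of_iso Subobject.botCoeIsoZero
  obtain ⟨T, -, hT⟩ := exists_maximal_subobject r ⊥ (fun S => Injective (S : 𝒜))
    ⟨fun _ _ _ => ⟨0, h0.eq_of_tgt _ _⟩⟩ ⟨fun _ _ _ => h0.eq_of_tgt _ _⟩
    (fun c hc hne h => hI G c hc hne h)
  refine ⟨T, hT.1.1, hT.1.2, fun {E} j hE hj => ?_⟩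
  have := hT.1.1
  have := mono_of_mono (biprod.desc T.arrow j) r
  have hle : Subobject.mk (biprod.desc T.arrow j) ≤ T := by
    refine hT.2 ⟨?_, ?_⟩ (Subobject.le_mk_of_comm biprod.inl (by simp))
    · exact Injective.of_iso (Subobject.underlyingIso (biprod.desc T.arrow j)).symm inferInstance
    · exact mono_mk_arrow_comp _ _ hj
  have hk := Subobject.ofMkLE_arrow hle
  have h1 : biprod.inr ≫ Subobject.ofMkLE _ _ hle ≫ biprod.inl =
      (biprod.inr : E ⟶ (T : 𝒜) ⊞ E) := by
    rw [← cancel_mono (biprod.desc T.arrow j)]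
    simp [hk]
  have h2 := h1 =≫ biprod.snd
  rw [IsZero.iff_id_eq_zero]
  simpa using h2.symm

/-- Lifting problems against all injective objects are detected by a set of injective objects. -/
lemma exists_injective_testFamily (hI : HasInjectiveChainUnions 𝒜) :
    ∃ (ι : Type v) (J : ι → 𝒜), (∀ i, Injective (J i)) ∧
      ∀ {A B : 𝒜} (p : A ⟶ B), (∀ i (f : J i ⟶ B), ∃ g : J i ⟶ A, g ≫ p = f) →
        ∀ {Z : 𝒜} (f : Z ⟶ B), Injective Z → ∃ g : Z ⟶ A, g ≫ p = f := by
  let G := separator 𝒜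
  let ι₀ := Σ A : Subobject G,
    {M : Subobject (Injective.under (cokernel A.arrow)) // Injective (M : 𝒜)}
  refine ⟨Shrink.{v} ι₀, fun i => ((equivShrink ι₀).symm i).2.1,
    fun i => ((equivShrink ι₀).symm i).2.2, fun {A B} p hp {Z} f hZ => ?_⟩
  replace hp : ∀ (K : Subobject G) (M : Subobject (Injective.under (cokernel K.arrow)))
      (_ : Injective (M : 𝒜)) (f : (M : 𝒜) ⟶ B), ∃ g : (M : 𝒜) ⟶ A, g ≫ p = f := by
    intro K M hM
    obtain ⟨i, hi⟩ := (equivShrink ι₀).symm.surjective ⟨K, M, hM⟩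
    have := hp i
    dsimp only at this
    rwa [hi] at this
  obtain ⟨T, hT, hTm, hmax⟩ := exists_maximal_injective_subobject hI (pullback.fst f p)
  let ρ : Z ⟶ T := Injective.factorThru (𝟙 _) (T.arrow ≫ pullback.fst f p)
  have hρ : (T.arrow ≫ pullback.fst f p) ≫ ρ = 𝟙 _ := Injective.comp_factorThru _ _
  have hker : IsZero (kernel ρ) := by
    have hZ2 : Injective (kernel ρ) :=
      Retract.injective (Y := Z) ⟨kernel.ι ρ,
        kernel.lift ρ (𝟙 Z - ρ ≫ T.arrow ≫ pullback.fst f p) (by simp [hρ]), by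
          rw [← cancel_mono (kernel.ι ρ)]; simp⟩
    rw [IsZero.iff_id_eq_zero]
    refine (Preadditive.isSeparator_iff G).1 (isSeparator_separator 𝒜) _ fun g => ?_
    rw [Category.comp_id]
    let K := kernelSubobject g
    let g' : cokernel K.arrow ⟶ kernel ρ := cokernel.desc _ g (kernelSubobject_arrow_comp g)
    have hg' : Mono g' := by
      refine Preadditive.mono_of_cancel_zero _ fun x hx => ?_
      obtain ⟨W, π, _, y, hy⟩ := surjective_up_to_refinements_of_epi (cokernel.π K.arrow) x
      have hyg : y ≫ g = 0 := by
        have := hy =≫ g'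
        simpa [g', hx] using this.symm
      rw [← cancel_epi π, hy, ← factorThruKernelSubobject_comp_arrow g y hyg, Category.assoc,
        cokernel.condition]
      simp
    let h : Injective.under (cokernel K.arrow) ⟶ kernel ρ := Injective.factorThru g' (Injective.ι _)
    have hh : Injective.ι _ ≫ h = g' := Injective.comp_factorThru _ _
    obtain ⟨M, t, hM, htm, hmh⟩ := exists_injective_of_mono_comp (Injective.ι _) h
      (by rw [hh]; exact hg')
    obtain ⟨l, hl⟩ := hp K M hM (M.arrow ≫ h ≫ kernel.ι ρ ≫ f)
    have hzero := hmax (pullback.lift (M.arrow ≫ h ≫ kernel.ι ρ) l (by simp [hl])) hM (by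
      have hm : Mono (M.arrow ≫ h ≫ kernel.ι ρ) := by
        rw [← Category.assoc]; infer_instance
      have := mono_biprod_desc (T.arrow ≫ pullback.fst f p) (M.arrow ≫ h ≫ kernel.ι ρ) ρ hρ
        (by simp)
      convert this using 1
      ext
      · simp
      · rw [biprod.inr_desc_assoc, biprod.inr_desc]
        exact pullback.lift_fst _ _ _)
    have hg0 : g' = 0 := by
      rw [← hh, ← htm, hzero.eq_of_src M.arrow 0]
      simp
    rw [← cokernel.π_desc K.arrow g (kernelSubobject_arrow_comp g)]
    exact (congrArg _ hg0).trans comp_zero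
  have hρm : Mono ρ := Preadditive.mono_of_isZero_kernel ρ hker
  have h1 : ρ ≫ T.arrow ≫ pullback.fst f p = 𝟙 Z := by
    rw [← cancel_mono ρ, Category.assoc, hρ]; simp
  exact ⟨ρ ≫ T.arrow ≫ pullback.snd f p, by
    rw [Category.assoc, Category.assoc, ← pullback.condition, ← Category.assoc, ← Category.assoc,
      Category.assoc ρ, h1, Category.id_comp]⟩
end InjectiveSubobjects

section SmallObject
open MorphismProperty

/-- In a Grothendieck abelian category, any set of monomorphisms permits the small object
argument. -/
lemma hasSmallObjectArgument_ofHoms_of_mono {𝒞 : Type u} [Category.{v} 𝒞] [Abelian 𝒞]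
    [IsGrothendieckAbelian.{v} 𝒞] {ι : Type v} {A B : ι → 𝒞} (f : ∀ i, A i ⟶ B i)
    [∀ i, Mono (f i)] : HasSmallObjectArgument.{v} (ofHoms f) := by
  have hle : ofHoms f ≤ monomorphisms 𝒞 := by
    rintro _ _ _ ⟨i⟩
    exact inferInstanceAs (Mono _)
  obtain ⟨κ, hκ', hκ⟩ := HasCardinalLT.exists_regular_cardinal_forall.{v}
    (fun i => Subobject (A i))
  have : Fact κ.IsRegular := ⟨hκ'⟩
  have : Nonempty κ.ord.ToType := by simpa using hκ'.ne_zero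
  have := WellFoundedLT.toOrderBot κ.ord.ToType
  exact ⟨κ, inferInstance, inferInstance,
    { preservesColimit {A B X Y} i hi f hf := by
        let hf' : (monomorphisms 𝒞).TransfiniteCompositionOfShape κ.ord.ToType f :=
          { toTransfiniteCompositionOfShape := hf.toTransfiniteCompositionOfShape
            map_mem j hj := by
              have := (hf.attachCells j hj).pushouts_coproducts
              simp only [ofHoms_homFamily] at this
              refine (?_ : _ ≤ monomorphisms 𝒞) _ this
              simp only [pushouts_le_iff, coproducts_le_iff]
              exact hle }
        have (j j' : κ.ord.ToType) (φ : j ⟶ j') : Mono (hf'.F.map φ) := hf'.mem_map φ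
        apply IsGrothendieckAbelian.preservesColimit_coyoneda_obj_of_mono (Y := hf'.F) (κ := κ)
        obtain ⟨i⟩ := hi
        exact hκ i }⟩
end SmallObject

section Disks
open HomologicalComplex
variable {𝒜 : Type u} [Category.{v} 𝒜] [Abelian 𝒜]

lemma down_rel_succ (n : ℤ) : (ComplexShape.down ℤ).Rel (n + 1) n := rfl

lemma int_succ_ne (n : ℤ) : n + 1 ≠ n := by simp

/-- The contractible complex with `M` in degrees `n + 1` and `n`. -/
noncomputable abbrev diskComplex (n : ℤ) (M : 𝒜) : ChainComplex 𝒜 ℤ :=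
  double (𝟙 M) (down_rel_succ n)

/-- Morphisms out of a disk are morphisms into the component of its top degree. -/
noncomputable def diskHomEquiv {n : ℤ} {M : 𝒜} {K : ChainComplex 𝒜 ℤ} :
    (diskComplex n M ⟶ K) ≃ (M ⟶ K.X (n + 1)) where
  toFun φ := (doubleXIso₀ _ (down_rel_succ n)).inv ≫ φ.f (n + 1)
  invFun a := mkHomFromDouble (down_rel_succ n) (int_succ_ne n) a (a ≫ K.d (n + 1) n)
    (by simp) (by simp)
  left_inv φ := by
    ext
    · simp
    · simp [double_d _ _ (int_succ_ne n)]
  right_inv a := by simp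

lemma diskHomEquiv_apply {n : ℤ} {M : 𝒜} {K : ChainComplex 𝒜 ℤ} (φ : diskComplex n M ⟶ K) :
    diskHomEquiv φ = (doubleXIso₀ _ (down_rel_succ n)).inv ≫ φ.f (n + 1) := rfl

lemma diskHomEquiv_symm_apply {n : ℤ} {M : 𝒜} {K : ChainComplex 𝒜 ℤ} (a : M ⟶ K.X (n + 1)) :
    diskHomEquiv.symm a = mkHomFromDouble (down_rel_succ n) (int_succ_ne n) a
      (a ≫ K.d (n + 1) n) (by simp) (by simp) := rfl

lemma diskHomEquiv_comp {n : ℤ} {M : 𝒜} {K L : ChainComplex 𝒜 ℤ} (φ : diskComplex n M ⟶ K)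
    (p : K ⟶ L) : diskHomEquiv (φ ≫ p) = diskHomEquiv φ ≫ p.f (n + 1) := by
  simp [diskHomEquiv_apply]

/-- The morphism of disks induced by a morphism of objects. -/
noncomputable def diskMap (n : ℤ) {M N : 𝒜} (g : M ⟶ N) : diskComplex n M ⟶ diskComplex n N :=
  diskHomEquiv.symm (g ≫ diskHomEquiv (𝟙 _))

lemma diskHomEquiv_diskMap_comp {n : ℤ} {M N : 𝒜} {K : ChainComplex 𝒜 ℤ} (g : M ⟶ N)
    (φ : diskComplex n N ⟶ K) : diskHomEquiv (diskMap n g ≫ φ) = g ≫ diskHomEquiv φ := by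
  rw [diskHomEquiv_comp, diskMap, Equiv.apply_symm_apply, Category.assoc, ← diskHomEquiv_comp,
    Category.id_comp]

lemma mono_diskMap (n : ℤ) {M N : 𝒜} (g : M ⟶ N) [Mono g] : Mono (diskMap n g) := by
  have h0 : (diskMap n g).f (n + 1) =
      (doubleXIso₀ _ (down_rel_succ n)).hom ≫ g ≫ (doubleXIso₀ _ (down_rel_succ n)).inv := by
    simp [diskMap, diskHomEquiv_symm_apply, diskHomEquiv_apply, double_d _ _ (int_succ_ne n)]
  have h1 : (diskMap n g).f n =
      (doubleXIso₁ _ (down_rel_succ n) (int_succ_ne n)).hom ≫ g ≫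
        (doubleXIso₁ _ (down_rel_succ n) (int_succ_ne n)).inv := by
    simp [diskMap, diskHomEquiv_symm_apply, diskHomEquiv_apply, double_d _ _ (int_succ_ne n)]
  refine Preadditive.mono_of_cancel_zero _ fun {K} x hx => ?_
  apply to_double_hom_ext
  · have := congr_hom hx (n + 1)
    rw [comp_f, h0] at this
    rw [← cancel_mono ((doubleXIso₀ _ (down_rel_succ n)).hom ≫ g ≫
      (doubleXIso₀ _ (down_rel_succ n)).inv), this]
    simp
  · have := congr_hom hx n
    rw [comp_f, h1] at this
    rw [← cancel_mono ((doubleXIso₁ _ (down_rel_succ n) (int_succ_ne n)).hom ≫ g ≫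
      (doubleXIso₁ _ (down_rel_succ n) (int_succ_ne n)).inv), this]
    simp

/-- The complex with `M` in degree `n`. -/
noncomputable abbrev sphereComplex (n : ℤ) (M : 𝒜) : ChainComplex 𝒜 ℤ :=
  (single 𝒜 (ComplexShape.down ℤ) n).obj M

/-- The inclusion of a sphere into a disk. -/
noncomputable def sphereToDisk (n : ℤ) (M : 𝒜) : sphereComplex n M ⟶ diskComplex n M :=
  mkHomFromSingle (doubleXIso₁ _ (down_rel_succ n) (int_succ_ne n)).inv
    (fun _ _ => by rw [double_d_eq_zero₀ _ _ _ _ (int_succ_ne n).symm, comp_zero])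

lemma mono_sphereToDisk (n : ℤ) (M : 𝒜) : Mono (sphereToDisk n M) := by
  have h1 : (sphereToDisk n M).f n =
      (singleObjXSelf _ _ _).hom ≫ (doubleXIso₁ _ (down_rel_succ n) (int_succ_ne n)).inv :=
    mkHomFromSingle_f _ _
  refine Preadditive.mono_of_cancel_zero _ fun {K} x hx => ?_
  apply to_single_hom_ext
  have := congr_hom hx n
  rw [comp_f, h1] at this
  rw [← cancel_mono ((singleObjXSelf _ _ _).hom ≫
    (doubleXIso₁ _ (down_rel_succ n) (int_succ_ne n)).inv), this]
  simp

lemma sphereToDisk_comp_f {n : ℤ} {M : 𝒜} {K : ChainComplex 𝒜 ℤ} (φ : diskComplex n M ⟶ K) :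
    (singleObjXSelf _ _ _).inv ≫ (sphereToDisk n M ≫ φ).f n = diskHomEquiv φ ≫ K.d (n + 1) n := by
  rw [diskHomEquiv_apply, Category.assoc, φ.comm]
  simp [sphereToDisk, double_d _ _ (int_succ_ne n)]

lemma hasLiftingProperty_diskMap_iff {n : ℤ} {M N : 𝒜} (g : M ⟶ N) {K L : ChainComplex 𝒜 ℤ}
    (p : K ⟶ L) : HasLiftingProperty (diskMap n g) p ↔ HasLiftingProperty g (p.f (n + 1)) := by
  constructor
  · refine fun h => ⟨fun {a b} sq => ?_⟩
    have sq' : CommSq (diskHomEquiv.symm a) (diskMap n g) p (diskHomEquiv.symm b) :=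
      ⟨diskHomEquiv.injective (by
        rw [diskHomEquiv_comp, diskHomEquiv_diskMap_comp]; simpa using sq.w)⟩
    refine ⟨⟨⟨diskHomEquiv sq'.lift, ?_, ?_⟩⟩⟩
    · rw [← diskHomEquiv_diskMap_comp, sq'.fac_left]; simp
    · rw [← diskHomEquiv_comp, sq'.fac_right]; simp
  · refine fun h => ⟨fun {a b} sq => ?_⟩
    have sq' : CommSq (diskHomEquiv a) g (p.f (n + 1)) (diskHomEquiv b) :=
      ⟨by rw [← diskHomEquiv_comp, ← diskHomEquiv_diskMap_comp, sq.w]⟩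
    refine ⟨⟨⟨diskHomEquiv.symm sq'.lift, ?_, ?_⟩⟩⟩
    · apply diskHomEquiv.injective
      rw [diskHomEquiv_diskMap_comp]; simp
    · apply diskHomEquiv.injective
      rw [diskHomEquiv_comp]; simp

lemma hasLiftingProperty_sphereToDisk {n : ℤ} {M : 𝒜} {K L : ChainComplex 𝒜 ℤ} (p : K ⟶ L)
    (h : ∀ (a : M ⟶ K.X n) (b : M ⟶ L.X (n + 1)), a ≫ K.d n (n - 1) = 0 →
      a ≫ p.f n = b ≫ L.d (n + 1) n → ∃ y : M ⟶ K.X (n + 1), y ≫ K.d (n + 1) n = a ∧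
        y ≫ p.f (n + 1) = b) : HasLiftingProperty (sphereToDisk n M) p := by
  refine ⟨fun {a b} sq => ?_⟩
  obtain ⟨y, hy, hy'⟩ := h ((singleObjXSelf _ _ _).inv ≫ a.f n) (diskHomEquiv b) (by simp) (by
    rw [← sphereToDisk_comp_f, ← sq.w]; simp)
  refine ⟨⟨⟨diskHomEquiv.symm y, ?_, ?_⟩⟩⟩
  · apply from_single_hom_ext
    rw [← cancel_epi (singleObjXSelf _ _ _).inv, sphereToDisk_comp_f]
    simpa using hy
  · apply diskHomEquiv.injective
    rw [diskHomEquiv_comp]; simpa using hy'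

lemma exists_lift_of_hasLiftingProperty_sphereToDisk {n : ℤ} {M : 𝒜} {K : ChainComplex 𝒜 ℤ}
    {Z : ChainComplex 𝒜 ℤ} (hZ : IsZero Z) (p : K ⟶ Z)
    (h : HasLiftingProperty (sphereToDisk n M) p)
    (a : M ⟶ K.X n) (ha : a ≫ K.d n (n - 1) = 0) :
    ∃ y : M ⟶ K.X (n + 1), y ≫ K.d (n + 1) n = a := by
  let a' : sphereComplex n M ⟶ K := mkHomFromSingle a (by
    intro k hk
    obtain rfl : k = n - 1 := by simp at hk; lia
    exact ha)
  have sq : CommSq a' (sphereToDisk n M) p 0 := ⟨hZ.eq_of_tgt _ _⟩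
  refine ⟨diskHomEquiv sq.lift, ?_⟩
  rw [← sphereToDisk_comp_f, sq.fac_left]
  simp [a']
end Disks

section TotallyAcyclic
variable {𝒜 : Type u} [Category.{v} 𝒜] [Abelian 𝒜]

/-- Every morphism from `J` to a cycle object of `C` lifts to a chain. -/
def LiftsCycles (J : 𝒜) (C : ChainComplex 𝒜 ℤ) : Prop :=
  ∀ i j k : ℤ, j + 1 = i → k + 1 = j → ∀ f : J ⟶ C.X j, f ≫ C.d j k = 0 →
    ∃ g : J ⟶ C.X i, g ≫ C.d i j = f

/-- An exact complex of injectives that stays exact under `Hom(J, -)` for injective `J`. -/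
structure IsTotallyAcyclic (C : ChainComplex 𝒜 ℤ) : Prop where
  injective : ∀ n, Injective (C.X n)
  exact : ∀ n, C.ExactAt n
  lift : ∀ J : 𝒜, Injective J → LiftsCycles J C

lemma exactAt_iff_of_succ (C : ChainComplex 𝒜 ℤ) {i j k : ℤ} (hij : j + 1 = i) (hjk : k + 1 = j) :
    C.ExactAt j ↔ (C.sc' i j k).Exact :=
  C.exactAt_iff' i j k (by simpa using hij) (by simp; lia)

lemma liftsCycles_iff_exactAt (J : 𝒜) (C : ChainComplex 𝒜 ℤ) :
    LiftsCycles J C ↔ ∀ n,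
      (((preadditiveCoyoneda.obj (Opposite.op J)).mapHomologicalComplex _).obj C).ExactAt n := by
  constructor
  · intro h n
    rw [HomologicalComplex.exactAt_iff' _ (n + 1) n (n - 1) (by simp) (by simp),
      ShortComplex.ab_exact_iff]
    exact fun f hf => h (n + 1) n (n - 1) rfl (by lia) f hf
  · intro h i j k hij hjk f hf
    have := h j
    rw [HomologicalComplex.exactAt_iff' _ i j k (by simpa using hij) (by simp; lia),
      ShortComplex.ab_exact_iff] at this
    exact this f hf

lemma liftsCycles_of_projective {P : 𝒜} [Projective P] {C : ChainComplex 𝒜 ℤ}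
    (hC : ∀ n, C.ExactAt n) : LiftsCycles P C := by
  intro i j k hij hjk f hf
  exact ⟨((exactAt_iff_of_succ C hij hjk).1 (hC j)).liftFromProjective f hf,
    ((exactAt_iff_of_succ C hij hjk).1 (hC j)).liftFromProjective_comp f hf⟩

lemma exact_of_separator_lifts {P : 𝒜} (hP : IsSeparator P) {S : ShortComplex 𝒜}
    (hS : ∀ f : P ⟶ S.X₂, f ≫ S.g = 0 → ∃ g : P ⟶ S.X₁, g ≫ S.f = f) : S.Exact := by
  rw [ShortComplex.exact_iff_epi_kernel_lift]
  refine Preadditive.epi_of_cancel_zero _ fun {Z} u hu => ?_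
  refine (Preadditive.isSeparator_iff P).1 hP u fun f => ?_
  obtain ⟨g, hg⟩ := hS (f ≫ kernel.ι _) (by simp)
  have : g ≫ kernel.lift _ _ S.zero = f := by
    rw [← cancel_mono (kernel.ι _), Category.assoc, kernel.lift_ι, hg]
  rw [← this, Category.assoc, hu, comp_zero]

lemma exactAt_of_liftsCycles {P : 𝒜} (hP : IsSeparator P) {C : ChainComplex 𝒜 ℤ}
    (hC : LiftsCycles P C) (n : ℤ) : C.ExactAt n :=
  (exactAt_iff_of_succ C rfl (k := n - 1) (by lia)).2
    (exact_of_separator_lifts hP fun f hf => hC (n + 1) n (n - 1) rfl (by lia) f hf)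

lemma isGorensteinInjective_iff {G : 𝒜} :
    IsGorensteinInjective G ↔ ∃ C : ChainComplex 𝒜 ℤ, IsTotallyAcyclic C ∧
      Nonempty (G ≅ kernel (C.d 0 (-1))) := by
  constructor
  · rintro ⟨C, h1, h2, h3, h4⟩
    exact ⟨C, ⟨h1, h2, fun J hJ => (liftsCycles_iff_exactAt J C).2 (h3 J hJ)⟩, h4⟩
  · rintro ⟨C, h, h4⟩
    exact ⟨C, h.injective, h.exact, fun J hJ => (liftsCycles_iff_exactAt J C).1 (h.lift J hJ), h4⟩

lemma liftsCycles_of_retract {J : 𝒜} {C D : ChainComplex 𝒜 ℤ} (r : Retract D C)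
    (h : LiftsCycles J C) : LiftsCycles J D := by
  intro i j k hij hjk f hf
  obtain ⟨g, hg⟩ := h i j k hij hjk (f ≫ r.i.f j) (by
    rw [Category.assoc, r.i.comm, reassoc_of% hf, zero_comp])
  refine ⟨g ≫ r.r.f i, ?_⟩
  rw [Category.assoc, r.r.comm, reassoc_of% hg, ← HomologicalComplex.comp_f, r.retract,
    HomologicalComplex.id_f, Category.comp_id]

lemma IsTotallyAcyclic.of_retract {C D : ChainComplex 𝒜 ℤ} {P : 𝒜} [Projective P]
    (hP : IsSeparator P) (r : Retract D C) (h : IsTotallyAcyclic C) : IsTotallyAcyclic D where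
  injective n := by
    have := h.injective n
    exact Retract.injective (Y := C.X n) ⟨r.i.f n, r.r.f n, by
      rw [← HomologicalComplex.comp_f, r.retract, HomologicalComplex.id_f]⟩
  exact := exactAt_of_liftsCycles hP
    (liftsCycles_of_retract r (liftsCycles_of_projective h.exact))
  lift J hJ := liftsCycles_of_retract r (h.lift J hJ)

lemma exists_totallyAcyclic_testFamily [IsGrothendieckAbelian.{v} 𝒜]
    (hI : HasInjectiveChainUnions 𝒜) {P : 𝒜} [Projective P] (hP : IsSeparator P) :
    ∃ (ι : Type v) (T : ι → 𝒜), (∀ i, T i = P ∨ Injective (T i)) ∧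
      ∀ C : ChainComplex 𝒜 ℤ, (∀ n, Injective (C.X n)) → (∀ i, LiftsCycles (T i) C) →
        IsTotallyAcyclic C := by
  obtain ⟨ι, J, hJ, h⟩ := exists_injective_testFamily hI
  refine ⟨Option ι, fun i => i.elim P J, ?_, fun C h1 h2 => ⟨h1, ?_, ?_⟩⟩
  · rintro (_ | i)
    · exact Or.inl rfl
    · exact Or.inr (hJ i)
  · exact exactAt_of_liftsCycles hP (h2 none)
  · intro Z hZ i j k hij hjk f hf
    have hd : C.d i j ≫ C.d j k = 0 := C.d_comp_d _ _ _
    obtain ⟨g, hg⟩ := h (kernel.lift (C.d j k) (C.d i j) hd) (fun a φ => by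
      obtain ⟨g, hg⟩ := (show LiftsCycles (J a) C from h2 (some a)) i j k hij hjk
        (φ ≫ kernel.ι _) (by rw [Category.assoc, kernel.condition, comp_zero])
      exact ⟨g, by rw [← cancel_mono (kernel.ι _), Category.assoc, kernel.lift_ι]; exact hg⟩)
      (kernel.lift _ f hf) hZ
    exact ⟨g, by rw [← kernel.lift_ι (C.d j k) f hf, ← hg, Category.assoc, kernel.lift_ι]⟩

lemma IsTotallyAcyclic.liftsCycles {C : ChainComplex 𝒜 ℤ} (h : IsTotallyAcyclic C) {J P : 𝒜}
    [Projective P] (hJ : J = P ∨ Injective J) : LiftsCycles J C := by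
  obtain rfl | hJ := hJ
  · exact liftsCycles_of_projective h.exact
  · exact h.lift J hJ
end TotallyAcyclic

section Disk
variable {𝒜 : Type u} [Category.{v} 𝒜] [Abelian 𝒜]
open HomologicalComplex

lemma exists_factor_diskComplex {n : ℤ} {M J : 𝒜} {i j k : ℤ} (hij : j + 1 = i) (hjk : k + 1 = j)
    (f : J ⟶ (diskComplex n M).X j) (hf : f ≫ (diskComplex n M).d j k = 0) :
    ∃ g : J ⟶ (diskComplex n M).X i, g ≫ (diskComplex n M).d i j = f := by
  by_cases hj : j = n
  · subst hj hij
    refine ⟨f ≫ (doubleXIso₁ _ (down_rel_succ j) (int_succ_ne j)).hom ≫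
      (doubleXIso₀ _ (down_rel_succ j)).inv, ?_⟩
    simp [double_d _ _ (int_succ_ne j)]
  · refine ⟨0, ?_⟩
    rw [zero_comp]
    by_cases hj' : j = n + 1
    · subst hj'
      obtain rfl : k = n := by lia
      rw [double_d _ _ (int_succ_ne k)] at hf
      rw [← cancel_mono ((doubleXIso₀ (𝟙 M) (down_rel_succ k)).hom ≫ 𝟙 M ≫
        (doubleXIso₁ (𝟙 M) (down_rel_succ k) (int_succ_ne k)).inv), hf, zero_comp]
    · exact (isZero_double_X (𝟙 M) (down_rel_succ n) j hj' hj).eq_of_tgt _ _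

lemma isTotallyAcyclic_diskComplex {P : 𝒜} (hP : IsSeparator P) (n : ℤ) (M : 𝒜) [Injective M] :
    IsTotallyAcyclic (diskComplex n M) where
  injective j := by
    by_cases h0 : j = n + 1
    · subst h0
      exact Injective.of_iso (doubleXIso₀ (𝟙 M) (down_rel_succ n)).symm inferInstance
    by_cases h1 : j = n
    · subst h1
      exact Injective.of_iso (doubleXIso₁ (𝟙 M) (down_rel_succ j) (int_succ_ne j)).symm
        inferInstance
    · exact (isZero_double_X (𝟙 M) (down_rel_succ n) j h0 h1).injective
  exact := exactAt_of_liftsCycles hP fun _ _ _ hij hjk f hf =>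
    exists_factor_diskComplex hij hjk f hf
  lift _ _ _ _ _ hij hjk f hf := exists_factor_diskComplex hij hjk f hf

/-- An injective object is a cycle object of a disk. -/
noncomputable def kernelDiskIso (M : 𝒜) : M ≅ kernel ((diskComplex 0 M).d 0 (-1)) :=
  (doubleXIso₁ (𝟙 M) (down_rel_succ 0) (int_succ_ne 0)).symm ≪≫ (kernelZeroIsoSource).symm ≪≫
    kernelIsoOfEq (double_d_eq_zero₀ _ _ _ _ (int_succ_ne 0).symm).symm
end Disk

section PathComplex
variable {𝒜 : Type u} [Category.{v} 𝒜] [Abelian 𝒜]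

/-- The path complex of `C`: maps into it are maps to `C` with a null-homotopy. -/
noncomputable def pathComplex (C : ChainComplex 𝒜 ℤ) : ChainComplex 𝒜 ℤ :=
  ChainComplex.of (fun n => C.X n ⊞ C.X (n + 1))
    (fun n => biprod.lift (biprod.fst ≫ C.d (n + 1) n)
      (biprod.fst - biprod.snd ≫ C.d (n + 1 + 1) (n + 1)))
    (fun n => by
      apply biprod.hom_ext
      · simp
      · simp [Preadditive.sub_comp])

lemma pathComplex_d (C : ChainComplex 𝒜 ℤ) (n : ℤ) :
    (pathComplex C).d (n + 1) n = biprod.lift (biprod.fst ≫ C.d (n + 1) n)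
      (biprod.fst - biprod.snd ≫ C.d (n + 1 + 1) (n + 1)) := by
  dsimp only [pathComplex, ChainComplex.of]
  exact ChainComplex.of_d _ _ n

/-- The projection from the path complex. -/
noncomputable def pathProj (C : ChainComplex 𝒜 ℤ) : pathComplex C ⟶ C where
  f n := (biprod.fst : C.X n ⊞ C.X (n + 1) ⟶ C.X n)
  comm' i j hij := by
    obtain rfl : j + 1 = i := hij
    rw [pathComplex_d]
    exact (biprod.lift_fst _ _).symm

/-- The degree one component of the null-homotopy encoded by the path complex. -/
noncomputable def pathSnd (C : ChainComplex 𝒜 ℤ) (n : ℤ) :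
    (pathComplex C).X n ⟶ C.X (n + 1) :=
  (biprod.snd : C.X n ⊞ C.X (n + 1) ⟶ C.X (n + 1))

/-- A morphism to a component of the path complex from its two coordinates. -/
noncomputable def pathLift (C : ChainComplex 𝒜 ℤ) {n : ℤ} {T : 𝒜} (a : T ⟶ C.X n)
    (b : T ⟶ C.X (n + 1)) : T ⟶ (pathComplex C).X n :=
  biprod.lift a b

@[simp]
lemma pathLift_pathProj (C : ChainComplex 𝒜 ℤ) {n : ℤ} {T : 𝒜} (a : T ⟶ C.X n)
    (b : T ⟶ C.X (n + 1)) : pathLift C a b ≫ (pathProj C).f n = a :=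
  biprod.lift_fst _ _

@[simp]
lemma pathLift_pathSnd (C : ChainComplex 𝒜 ℤ) {n : ℤ} {T : 𝒜} (a : T ⟶ C.X n)
    (b : T ⟶ C.X (n + 1)) : pathLift C a b ≫ pathSnd C n = b :=
  biprod.lift_snd _ _

lemma path_hom_ext {C : ChainComplex 𝒜 ℤ} {n : ℤ} {T : 𝒜} {a b : T ⟶ (pathComplex C).X n}
    (h₁ : a ≫ (pathProj C).f n = b ≫ (pathProj C).f n)
    (h₂ : a ≫ pathSnd C n = b ≫ pathSnd C n) : a = b :=
  biprod.hom_ext _ _ h₁ h₂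

lemma pathComplex_d_pathSnd (C : ChainComplex 𝒜 ℤ) (n : ℤ) :
    (pathComplex C).d (n + 1) n ≫ pathSnd C n =
      (pathProj C).f (n + 1) - pathSnd C (n + 1) ≫ C.d (n + 1 + 1) (n + 1) := by
  rw [pathComplex_d]
  exact biprod.lift_snd _ _

lemma hasLiftingProperty_diskMap_pathProj {C : ChainComplex 𝒜 ℤ} (hC : ∀ n, Injective (C.X n))
    (n : ℤ) {M N : 𝒜} (g : M ⟶ N) [Mono g] : HasLiftingProperty (diskMap n g) (pathProj C) := by
  rw [hasLiftingProperty_diskMap_iff]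
  refine ⟨fun {a b} sq => ?_⟩
  have := hC (n + 1 + 1)
  refine ⟨⟨⟨pathLift C b (Injective.factorThru (a ≫ pathSnd C (n + 1)) g), ?_, ?_⟩⟩⟩
  · apply path_hom_ext
    · simpa using sq.w.symm
    · simp
  · simp

lemma hasLiftingProperty_sphereToDisk_pathProj {C : ChainComplex 𝒜 ℤ} {M : 𝒜}
    (hC : LiftsCycles M C) (n : ℤ) : HasLiftingProperty (sphereToDisk n M) (pathProj C) := by
  refine hasLiftingProperty_sphereToDisk _ fun a b ha hab => ?_
  have ha' : ∀ k, k + 1 = n → a ≫ (pathComplex C).d n k = 0 := fun k hk => by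
    obtain rfl : k = n - 1 := by lia
    exact ha
  obtain ⟨m, rfl⟩ : ∃ m, m + 1 = n := ⟨n - 1, by lia⟩
  have h2 := congrArg (· ≫ pathSnd C m) (ha' m rfl)
  simp only [Category.assoc, pathComplex_d_pathSnd, Preadditive.comp_sub, zero_comp] at h2
  rw [sub_eq_zero, hab] at h2
  obtain ⟨w, hw⟩ := hC (m + 1 + 1 + 1) (m + 1 + 1) (m + 1) rfl rfl (b - a ≫ pathSnd C (m + 1)) (by
    rw [Preadditive.sub_comp, Category.assoc, h2, sub_self])
  refine ⟨pathLift C b w, path_hom_ext ?_ ?_, by simp⟩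
  · rw [Category.assoc, ← (pathProj C).comm, reassoc_of% (pathLift_pathProj C b w), hab]
  · rw [Category.assoc, pathComplex_d_pathSnd, Preadditive.comp_sub, pathLift_pathProj,
      reassoc_of% (pathLift_pathSnd C b w), hw, sub_sub_cancel]
end PathComplex

section Replacement
variable {𝒜 : Type u} [Category.{v} 𝒜] [Abelian 𝒜] 
open MorphismProperty ZeroObject

/-- A set of monomorphisms of complexes detecting the totally acyclic complexes. -/
noncomputable def generatingArrow (G : 𝒜) {ι : Type v} (T : ι → 𝒜) :
    ℤ × (Subobject G ⊕ ι) → Arrow (ChainComplex 𝒜 ℤ)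
  | (n, Sum.inl S) => Arrow.mk (diskMap n S.arrow)
  | (n, Sum.inr i) => Arrow.mk (sphereToDisk n (T i))

lemma mono_generatingArrow (G : 𝒜) {ι : Type v} (T : ι → 𝒜) (x) :
    Mono (generatingArrow G T x).hom := by
  obtain ⟨n, S | i⟩ := x
  · exact mono_diskMap n S.arrow
  · exact mono_sphereToDisk n (T i)

variable [IsGrothendieckAbelian.{v} 𝒜]

lemma exists_totallyAcyclic_replacement (hI : HasInjectiveChainUnions 𝒜) {P : 𝒜} [Projective P]
    (hP : IsSeparator P) (K : ChainComplex 𝒜 ℤ) :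
    ∃ (C : ChainComplex 𝒜 ℤ) (a : K ⟶ C), IsTotallyAcyclic C ∧
      (∀ {D : ChainComplex 𝒜 ℤ}, IsTotallyAcyclic D → ∀ f : K ⟶ D, ∃ g : C ⟶ D, a ≫ g = f) ∧
      ∀ {D : ChainComplex 𝒜 ℤ}, IsTotallyAcyclic D → HasLiftingProperty a (pathProj D) := by
  obtain ⟨ι, T, hT, hT'⟩ := exists_totallyAcyclic_testFamily hI hP
  let e := equivShrink.{v} (ℤ × (Subobject P ⊕ ι))
  let F := generatingArrow P T
  have hF (x) : Mono (F (e.symm x)).hom := mono_generatingArrow P T _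
  let I := ofHoms fun x => (F (e.symm x)).hom
  have hI' (x) : I (F x).hom := by
    simpa [I, ofHoms_iff] using ⟨e x, by simp⟩
  have : HasSmallObjectArgument.{v} I := hasSmallObjectArgument_ofHoms_of_mono _
  let Φ := factorizationData I.rlp.llp I.rlp (0 : K ⟶ 0)
  have hrlp {A B : ChainComplex 𝒜 ℤ} (p : A ⟶ B) (h1 : ∀ n S, HasLiftingProperty
      (diskMap n (Subobject.arrow (X := P) S)) p)
      (h2 : ∀ n i, HasLiftingProperty (sphereToDisk n (T i)) p) : I.rlp p := by
    rintro _ _ _ ⟨x⟩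
    generalize e.symm x = y
    obtain ⟨n, S | i⟩ := y
    · exact h1 n S
    · exact h2 n i
  refine ⟨Φ.Z, Φ.i, ?_, ?_, ?_⟩
  · refine hT' _ (fun n => ?_) fun i => ?_
    · obtain ⟨m, rfl⟩ : ∃ m, m + 1 = n := ⟨n - 1, by lia⟩
      have hz : IsZero ((0 : ChainComplex 𝒜 ℤ).X (m + 1)) :=
        (HomologicalComplex.eval 𝒜 _ (m + 1)).map_isZero (isZero_zero _)
      rw [injective_iff_rlp_monomorphisms_of_isZero (Φ.p.f (m + 1)) hz,
        ← IsGrothendieckAbelian.generatingMonomorphisms_rlp hP]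
      rintro _ _ _ ⟨S⟩
      rw [← hasLiftingProperty_diskMap_iff]
      exact Φ.hp _ (hI' (m, Sum.inl S))
    · rintro _ j k rfl rfl f hf
      exact exists_lift_of_hasLiftingProperty_sphereToDisk (isZero_zero _) Φ.p
        (Φ.hp _ (hI' (_, Sum.inr i))) f (by
          have : ∀ l, l = k → f ≫ Φ.Z.d (k + 1) l = 0 := by rintro _ rfl; exact hf
          exact this _ (by lia))
  · intro D hD f
    have : HasLiftingProperty Φ.i (0 : D ⟶ 0) := by
      refine Φ.hi _ (hrlp _ (fun n S => ?_) fun n i => ?_)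
      · rw [hasLiftingProperty_diskMap_iff]
        have := hD.injective (n + 1)
        exact Injective.hasLiftingProperty_of_isZero _ _
          ((HomologicalComplex.eval 𝒜 _ (n + 1)).map_isZero (isZero_zero _))
      · refine hasLiftingProperty_sphereToDisk _ fun x y hx _ => ?_
        obtain ⟨z, hz⟩ := hD.liftsCycles (hT i) (n + 1) n (n - 1) rfl (by lia) x hx
        exact ⟨z, hz, ((HomologicalComplex.eval 𝒜 _ (n + 1)).map_isZero (isZero_zero _)).eq_of_tgt
          _ _⟩
    have sq : CommSq f Φ.i (0 : D ⟶ 0) 0 := ⟨by simp⟩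
    exact ⟨sq.lift, sq.fac_left⟩
  · intro D hD
    exact Φ.hi _ (hrlp _ (fun n S => hasLiftingProperty_diskMap_pathProj hD.injective n _)
      fun n i => hasLiftingProperty_sphereToDisk_pathProj (hD.liftsCycles (hT i)) n)
end Replacement

section Endomorphisms
variable {𝒜 : Type u} [Category.{v} 𝒜] [Abelian 𝒜] [IsGrothendieckAbelian.{v} 𝒜]

/-- Endomorphisms annihilating `φ` factor through injectives, by morphisms annihilating `φ`. -/
def FactorsThroughInjectives {X G : 𝒜} (φ : X ⟶ G) : Prop :=
  ∀ δ : G ⟶ G, φ ≫ δ = 0 → ∃ (E : 𝒜) (w : G ⟶ E) (u : E ⟶ G),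
    Injective E ∧ φ ≫ w = 0 ∧ w ≫ u = δ

/-- No nonzero injective subobject of the target of `φ` is disjoint from `φ`. -/
def HasNoDisjointInjectives {X G : 𝒜} (φ : X ⟶ G) : Prop :=
  ∀ {E : 𝒜} (j : E ⟶ G), Injective E → Mono (j ≫ cokernel.π φ) → IsZero E

lemma isIso_of_factorsThroughInjectives {X G : 𝒜} {φ : X ⟶ G} [Mono φ]
    (h₁ : FactorsThroughInjectives φ) (h₂ : HasNoDisjointInjectives φ) {f : G ⟶ G}
    (hf : φ ≫ f = φ) : IsIso f := by
  obtain ⟨E, w, u, hE, hw, hwu⟩ := h₁ (f - 𝟙 G) (by simp [hf])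
  have hfm : Mono f := by
    refine Preadditive.mono_of_kernel_zero ?_
    have hn : (kernel.ι f ≫ w) ≫ u = - kernel.ι f := by
      rw [Category.assoc, hwu]; simp
    have hπ : Mono ((kernel.ι f ≫ w) ≫ u ≫ cokernel.π φ) := by
      rw [← Category.assoc, hn, Preadditive.neg_comp]
      have := mono_kernel_ι_comp_cokernel_π φ f (by rw [hf]; infer_instance)
      infer_instance
    obtain ⟨M, t, hM, htM, hMm⟩ := exists_injective_of_mono_comp (kernel.ι f ≫ w)
      (u ≫ cokernel.π φ) hπ
    have hM0 := h₂ (M.arrow ≫ u) hM (by rwa [Category.assoc])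
    rw [← neg_eq_zero, ← hn, ← htM, hM0.eq_of_tgt t 0, zero_comp, zero_comp]
  let v : G ⟶ E := Injective.factorThru w f
  have hv : f ≫ v = w := Injective.comp_factorThru w f
  let g : G ⟶ G := 𝟙 G - v ≫ u
  have hfg : f ≫ g = 𝟙 G := by
    simp only [g, Preadditive.comp_sub, Category.comp_id, reassoc_of% hv, hwu, sub_sub_cancel]
  have hφg : φ ≫ g = φ := by
    conv_lhs => rw [← hf]
    rw [Category.assoc, hfg, Category.comp_id]
  have hkv : kernel.ι g ≫ v ≫ u = kernel.ι g := by
    have := kernel.condition g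
    simp only [g, Preadditive.comp_sub, Category.comp_id, sub_eq_zero] at this
    exact this.symm
  have hinj : Injective (kernel g) :=
    Retract.injective (Y := E) ⟨kernel.ι g ≫ v, u ≫ kernel.lift g (𝟙 G - g ≫ f) (by
      rw [Preadditive.sub_comp, Category.assoc, hfg]; simp), by
      rw [← cancel_mono (kernel.ι g)]
      simp only [Category.assoc, kernel.lift_ι, reassoc_of% hkv]
      simp [Preadditive.comp_sub]⟩
  have hzero := h₂ (kernel.ι g) hinj
    (mono_kernel_ι_comp_cokernel_π φ g (by rw [hφg]; infer_instance))
  have hgm : Mono g := Preadditive.mono_of_kernel_zero (hzero.eq_of_src _ _)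
  have : IsIso g := by
    have : IsSplitEpi g := ⟨⟨⟨f, hfg⟩⟩⟩
    exact isIso_of_mono_of_isSplitEpi g
  rw [← IsIso.inv_eq_of_inv_hom_id hfg]
  infer_instance
end Endomorphisms

section Gluing

lemma exists_int_section {α : ℤ → Type v} (R : ∀ i j, α i → α j → Prop)
    (hup : ∀ n (a : α n), ∃ b : α (n + 1), R n (n + 1) a b)
    (hdown : ∀ n (b : α n), ∃ a : α (n - 1), R (n - 1) n a b) (a₀ : α 0) :
    ∃ s : ∀ n, α n, s 0 = a₀ ∧ ∀ i j, i + 1 = j → R i j (s i) (s j) := by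
  choose up hup using hup
  choose down hdown using hdown
  let s : ∀ n, α n := fun n => Int.inductionOn' n 0 a₀ (fun k _ a => up k a)
    (fun k _ a => down k a)
  refine ⟨s, Int.inductionOn'_self .., ?_⟩
  rintro i _ rfl
  by_cases hi : 0 ≤ i
  · have : s (i + 1) = up i (s i) := Int.inductionOn'_add_one (hz := hi) ..
    rw [this]
    exact hup _ _
  · obtain ⟨j, rfl⟩ : ∃ j, i = j - 1 := ⟨i + 1, by lia⟩
    have : s (j - 1) = down j (s j) := Int.inductionOn'_sub_one (hz := by lia) ..
    rw [this]
    have h : ∀ k, k = j → R (j - 1) k (down j (s j)) (s k) := by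
      rintro _ rfl; exact hdown _ _
    exact h _ (by lia)
end Gluing

section Comparison
variable {𝒜 : Type u} [Category.{v} 𝒜] [Abelian 𝒜]

lemma exists_extension_to_chainMap {C D : ChainComplex 𝒜 ℤ} (hC : IsTotallyAcyclic C)
    (hD : IsTotallyAcyclic D) (δ : kernel (C.d 0 (-1)) ⟶ kernel (D.d 0 (-1))) :
    ∃ Δ : C ⟶ D, kernel.ι _ ≫ Δ.f 0 = δ ≫ kernel.ι _ := by
  let α : ℤ → Type v := fun n =>
    {f : C.X n ⟶ D.X n // ∀ i k, n + 1 = i → k + 1 = n → C.d i n ≫ f ≫ D.d n k = 0}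
  let R : ∀ i j, α i → α j → Prop := fun i j a b => C.d j i ≫ a.1 = b.1 ≫ D.d j i
  have hD0 := hD.injective 0
  let f₀ : C.X 0 ⟶ D.X 0 := Injective.factorThru (δ ≫ kernel.ι _) (kernel.ι (C.d 0 (-1)))
  have hf₀ : kernel.ι (C.d 0 (-1)) ≫ f₀ = δ ≫ kernel.ι _ := Injective.comp_factorThru _ _
  have hf₀' : ∀ i k, (0 : ℤ) + 1 = i → k + 1 = 0 → C.d i 0 ≫ f₀ ≫ D.d 0 k = 0 := by
    rintro i k rfl hk
    obtain rfl : k = -1 := by lia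
    rw [← kernel.lift_ι (C.d 0 (-1)) (C.d (0 + 1) 0) (C.d_comp_d _ _ _), Category.assoc,
      reassoc_of% hf₀]
    simp
  have hup (n) (a : α n) : ∃ b : α (n + 1), R n (n + 1) a b := by
    obtain ⟨a, ha⟩ := a
    obtain ⟨g, hg⟩ := hD.lift (C.X (n + 1)) (hC.injective _) (n + 1) n (n - 1) rfl (by lia)
      (C.d (n + 1) n ≫ a) (by simpa using ha _ _ rfl (by lia))
    refine ⟨⟨g, ?_⟩, hg.symm⟩
    rintro i k rfl hk
    obtain rfl : k = n := by lia
    simp [hg]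
  have hdown (n) (b : α n) : ∃ a : α (n - 1), R (n - 1) n a b := by
    obtain ⟨b, hb⟩ := b
    have hinj := hD.injective (n - 1)
    have hex := (exactAt_iff_of_succ C (i := n + 1) (k := n - 1) rfl (by lia)).1 (hC.exact n)
    let a : C.X (n - 1) ⟶ D.X (n - 1) :=
      hex.descToInjective (b ≫ D.d n (n - 1)) (hb _ _ rfl (by lia))
    have ha : C.d n (n - 1) ≫ a = b ≫ D.d n (n - 1) :=
      hex.comp_descToInjective (b ≫ D.d n (n - 1)) (hb _ _ rfl (by lia))
    refine ⟨⟨a, ?_⟩, ha⟩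
    rintro i k hi hk
    obtain rfl : i = n := by lia
    rw [reassoc_of% ha]
    simp
  obtain ⟨s, hs₀, hs⟩ := exists_int_section R hup hdown ⟨f₀, hf₀'⟩
  let Δ : C ⟶ D :=
    { f := fun n => (s n).1
      comm' := fun i j hij => (hs j i (by simpa using hij)).symm }
  have hΔ : Δ.f 0 = f₀ := congrArg Subtype.val hs₀
  exact ⟨Δ, by rw [hΔ, hf₀]⟩
end Comparison

section ToDisk
open HomologicalComplex
variable {𝒜 : Type u} [Category.{v} 𝒜] [Abelian 𝒜]

/-- The components of `toDisk`. -/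
noncomputable def toDiskF {C : ChainComplex 𝒜 ℤ} {n : ℤ} {M : 𝒜} (a : C.X n ⟶ M) (k : ℤ) :
    C.X k ⟶ (diskComplex n M).X k :=
  if h : k = n + 1 then
    C.d k n ≫ a ≫ (doubleXIso₀ (𝟙 M) (down_rel_succ n)).inv ≫ eqToHom (by rw [h])
  else if h : k = n then eqToHom (by rw [h]) ≫ a ≫
    (doubleXIso₁ (𝟙 M) (down_rel_succ n) (int_succ_ne n)).inv ≫ eqToHom (by rw [h])
  else 0

lemma toDiskF_succ {C : ChainComplex 𝒜 ℤ} {n : ℤ} {M : 𝒜} (a : C.X n ⟶ M) :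
    toDiskF a (n + 1) = C.d (n + 1) n ≫ a ≫ (doubleXIso₀ (𝟙 M) (down_rel_succ n)).inv := by
  simp [toDiskF]

lemma toDiskF_self {C : ChainComplex 𝒜 ℤ} {n : ℤ} {M : 𝒜} (a : C.X n ⟶ M) :
    toDiskF a n = a ≫ (doubleXIso₁ (𝟙 M) (down_rel_succ n) (int_succ_ne n)).inv := by
  simp [toDiskF]

/-- The morphism to a disk determined by its component in the bottom degree. -/
noncomputable def toDisk {C : ChainComplex 𝒜 ℤ} {n : ℤ} {M : 𝒜} (a : C.X n ⟶ M) :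
    C ⟶ diskComplex n M where
  f k := toDiskF a k
  comm' i j hij := by
    obtain rfl : j + 1 = i := hij
    by_cases hj : j = n
    · subst hj
      rw [toDiskF_succ, toDiskF_self, double_d _ _ (int_succ_ne j)]
      simp
    · by_cases hj' : j = n + 1
      · subst hj'
        rw [toDiskF_succ, (isZero_double_X (𝟙 M) (down_rel_succ n) (n + 1 + 1) (by lia)
          (by lia)).eq_of_src ((diskComplex n M).d _ _) 0]
        simp
      · exact (isZero_double_X (𝟙 M) (down_rel_succ n) j hj' hj).eq_of_tgt _ _

lemma diskHomEquiv_symm_toDisk {C : ChainComplex 𝒜 ℤ} {n : ℤ} {M N : 𝒜} (a : C.X n ⟶ M)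
    (s : N ⟶ C.X (n + 1)) : diskHomEquiv (diskHomEquiv.symm s ≫ toDisk a) =
      s ≫ C.d (n + 1) n ≫ a ≫ (doubleXIso₀ (𝟙 M) (down_rel_succ n)).inv := by
  rw [diskHomEquiv_comp, Equiv.apply_symm_apply]
  exact congrArg (s ≫ ·) (toDiskF_succ a)

lemma diskHomEquiv_symm_comp_toDisk {C : ChainComplex 𝒜 ℤ} {n : ℤ} {M : 𝒜} (a : C.X n ⟶ M)
    (s : M ⟶ C.X (n + 1)) (h : s ≫ C.d (n + 1) n ≫ a = 𝟙 M) :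
    diskHomEquiv.symm s ≫ toDisk a = 𝟙 _ := by
  apply diskHomEquiv.injective
  rw [diskHomEquiv_symm_toDisk, reassoc_of% h, diskHomEquiv_apply]
  simp

lemma toDisk_comp_f {C D : ChainComplex 𝒜 ℤ} {n : ℤ} {M : 𝒜} (a : C.X n ⟶ M)
    (s : M ⟶ D.X (n + 1)) :
    (toDisk a ≫ diskHomEquiv.symm s).f n = a ≫ s ≫ D.d (n + 1) n := by
  rw [comp_f, diskHomEquiv_symm_apply]
  change toDiskF a n ≫ _ = _
  rw [toDiskF_self]
  simp
end ToDisk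

section Cycles
variable {𝒜 : Type u} [Category.{v} 𝒜] [Abelian 𝒜]
open HomologicalComplex

/-- The morphism induced on cycles of degree zero. -/
noncomputable def zeroCyclesMap {C D : ChainComplex 𝒜 ℤ} (Δ : C ⟶ D) :
    kernel (C.d 0 (-1)) ⟶ kernel (D.d 0 (-1)) :=
  kernel.map _ _ (Δ.f 0) (Δ.f (-1)) (Δ.comm _ _).symm

@[simp]
lemma zeroCyclesMap_ι {C D : ChainComplex 𝒜 ℤ} (Δ : C ⟶ D) :
    zeroCyclesMap Δ ≫ kernel.ι _ = kernel.ι _ ≫ Δ.f 0 := by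
  simp [zeroCyclesMap]

lemma zeroCyclesMap_comp {C D E : ChainComplex 𝒜 ℤ} (Δ : C ⟶ D) (Γ : D ⟶ E) :
    zeroCyclesMap (Δ ≫ Γ) = zeroCyclesMap Δ ≫ zeroCyclesMap Γ := by
  rw [← cancel_mono (kernel.ι _)]; simp [reassoc_of% (zeroCyclesMap_ι Δ)]

/-- The morphism from a sphere determined by a morphism to the cycles. -/
noncomputable def sphereHom {D : ChainComplex 𝒜 ℤ} {X : 𝒜} (f : X ⟶ kernel (D.d 0 (-1))) :
    sphereComplex 0 X ⟶ D :=
  mkHomFromSingle (f ≫ kernel.ι _) (by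
    intro k hk
    obtain rfl : k = -1 := by simp at hk; lia
    simp)

lemma sphereHom_f {D : ChainComplex 𝒜 ℤ} {X : 𝒜} (f : X ⟶ kernel (D.d 0 (-1))) :
    (singleObjXSelf _ _ _).inv ≫ (sphereHom f).f 0 = f ≫ kernel.ι _ := by
  simp [sphereHom]

lemma path_cycle {D : ChainComplex 𝒜 ℤ} {T : 𝒜} {j k : ℤ} (hk : k + 1 = j)
    (y : T ⟶ (pathComplex D).X j) (hy : y ≫ (pathComplex D).d j k = 0) :
    y ≫ (pathProj D).f j = y ≫ pathSnd D j ≫ D.d (j + 1) j := by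
  subst hk
  have := congrArg (· ≫ pathSnd D k) hy
  simpa [pathComplex_d_pathSnd, sub_eq_zero] using this

lemma exists_cycle_replacement [IsGrothendieckAbelian.{v} 𝒜] (hI : HasInjectiveChainUnions 𝒜)
    {P : 𝒜} [Projective P] (hP : IsSeparator P) (X : 𝒜) :
    ∃ (C : ChainComplex 𝒜 ℤ) (φ : X ⟶ kernel (C.d 0 (-1))), IsTotallyAcyclic C ∧
      (∀ {D : ChainComplex 𝒜 ℤ}, IsTotallyAcyclic D → ∀ f : X ⟶ kernel (D.d 0 (-1)),
        ∃ g : kernel (C.d 0 (-1)) ⟶ kernel (D.d 0 (-1)), φ ≫ g = f) ∧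
      ∀ {D : ChainComplex 𝒜 ℤ}, IsTotallyAcyclic D → ∀ Δ : C ⟶ D, φ ≫ kernel.ι _ ≫ Δ.f 0 = 0 →
        ∃ h : C ⟶ pathComplex D, h ≫ pathProj D = Δ ∧ φ ≫ kernel.ι _ ≫ h.f 0 = 0 := by
  obtain ⟨C, a, hC, hext, hlift⟩ := exists_totallyAcyclic_replacement hI hP (sphereComplex 0 X)
  let φ : X ⟶ kernel (C.d 0 (-1)) :=
    kernel.lift _ ((singleObjXSelf _ _ _).inv ≫ a.f 0) (by simp)
  have hφ : φ ≫ kernel.ι _ = (singleObjXSelf _ _ _).inv ≫ a.f 0 := kernel.lift_ι _ _ _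
  refine ⟨C, φ, hC, fun {D} hD f => ?_, fun {D} hD Δ hΔ => ?_⟩
  · obtain ⟨g, hg⟩ := hext hD (sphereHom f)
    refine ⟨zeroCyclesMap g, ?_⟩
    rw [← cancel_mono (kernel.ι _), Category.assoc, zeroCyclesMap_ι, reassoc_of% hφ,
      ← sphereHom_f, ← hg, comp_f]
  · have := hlift hD
    have sq : CommSq (0 : _ ⟶ pathComplex D) a (pathProj D) Δ := ⟨by
      apply from_single_hom_ext
      rw [reassoc_of% hφ] at hΔ
      rw [← cancel_epi (singleObjXSelf _ _ _).inv]
      simpa using hΔ.symm⟩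
    refine ⟨sq.lift, sq.fac_right, ?_⟩
    rw [reassoc_of% hφ, ← comp_f, sq.fac_left]
    simp

lemma factorsThroughInjectives_of_path {C : ChainComplex 𝒜 ℤ} (hC : IsTotallyAcyclic C) {X : 𝒜}
    (φ : X ⟶ kernel (C.d 0 (-1)))
    (h : ∀ Δ : C ⟶ C, φ ≫ kernel.ι _ ≫ Δ.f 0 = 0 →
      ∃ h : C ⟶ pathComplex C, h ≫ pathProj C = Δ ∧ φ ≫ kernel.ι _ ≫ h.f 0 = 0) :
    FactorsThroughInjectives φ := by
  intro δ hδ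
  obtain ⟨Δ, hΔ⟩ := exists_extension_to_chainMap hC hC δ
  obtain ⟨h, hh, hφ⟩ := h Δ (by rw [hΔ, reassoc_of% hδ, zero_comp])
  have hcyc := path_cycle (k := -1) (by lia) (kernel.ι (C.d 0 (-1)) ≫ h.f 0) (by
    rw [Category.assoc, h.comm, kernel.condition_assoc, zero_comp])
  refine ⟨_, kernel.ι _ ≫ h.f 0 ≫ pathSnd C 0,
    kernel.lift _ (C.d (0 + 1) 0) (C.d_comp_d _ _ _), hC.injective _, ?_, ?_⟩
  · rw [reassoc_of% hφ, zero_comp]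
  · simp only [Category.assoc] at hcyc
    rw [← cancel_mono (kernel.ι _), ← hΔ, ← hh, comp_f, hcyc]
    simp
end Cycles

section Reduction
variable {𝒜 : Type u} [Category.{v} 𝒜] [Abelian 𝒜]

lemma FactorsThroughInjectives.of_retract {X G G' : 𝒜} {φ : X ⟶ G}
    (h : FactorsThroughInjectives φ) (r : Retract G' G) (hr : φ ≫ r.r ≫ r.i = φ) :
    FactorsThroughInjectives (φ ≫ r.r) := by
  intro δ hδ
  obtain ⟨E, w, u, hE, hw, hwu⟩ := h (r.r ≫ δ ≫ r.i) (by
    rw [← Category.assoc, ← Category.assoc, hδ, zero_comp])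
  refine ⟨E, r.i ≫ w, u ≫ r.r, hE, ?_, ?_⟩
  · rw [Category.assoc, reassoc_of% hr, hw]
  · rw [Category.assoc, reassoc_of% hwu]
    simp

lemma HasNoDisjointInjectives.of_retract {X G G' T : 𝒜} {φ : X ⟶ G} [Mono φ] (r : Retract G' G)
    (t : T ⟶ G) (ht : Mono (t ≫ cokernel.π φ)) (htr : t ≫ r.r = 0)
    (hmax : ∀ {E : 𝒜} (j : E ⟶ G), Injective E → Mono (biprod.desc t j ≫ cokernel.π φ) →
      IsZero E) : HasNoDisjointInjectives (φ ≫ r.r) := by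
  intro E j hE hj
  refine hmax (j ≫ r.i) hE (Preadditive.mono_of_cancel_zero _ fun x hx => ?_)
  obtain ⟨z, hz⟩ := exists_lift_of_comp_cokernel_eq_zero φ (x ≫ biprod.desc t (j ≫ r.i))
    (by rwa [Category.assoc])
  have h1 : z ≫ φ ≫ r.r = (x ≫ biprod.snd) ≫ j := by
    have := congrArg (· ≫ r.r) hz
    simp only [Category.assoc, biprod.desc_eq, Preadditive.add_comp, Preadditive.comp_add, htr,
      r.retract, comp_zero, zero_add, Category.comp_id] at this
    rw [this, Category.assoc]
  have h2 : x ≫ biprod.snd = 0 := by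
    rw [← cancel_mono (j ≫ cokernel.π (φ ≫ r.r)), ← Category.assoc, ← h1]
    simp
  have h3 : x ≫ biprod.fst = 0 := by
    rw [← cancel_mono (t ≫ cokernel.π φ)]
    have : (x ≫ biprod.fst) ≫ t = z ≫ φ := by
      rw [hz, biprod.desc_eq, Preadditive.comp_add, reassoc_of% h2]
      simp
    rw [← Category.assoc, this]
    simp
  apply biprod.hom_ext <;> simp [h2, h3]

/-- In a Grothendieck abelian category with a projective separator where unions of chains of
injective subobjects are injective, the Gorenstein injective objects form an enveloping class. -/
theorem exists_isEnvelope_isGorensteinInjective [IsGrothendieckAbelian.{v} 𝒜]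
    (hI : HasInjectiveChainUnions 𝒜) {P : 𝒜} [Projective P] (hP : IsSeparator P) (X : 𝒜) :
    ∃ (G : 𝒜) (ψ : X ⟶ G), IsEnvelope (fun K => IsGorensteinInjective K) ψ := by
  obtain ⟨C, φ, hC, hext, hpath⟩ := exists_cycle_replacement hI hP X
  have hφ : Mono φ := by
    obtain ⟨g, hg⟩ := hext (isTotallyAcyclic_diskComplex hP 0 (Injective.under X))
      (Injective.ι X ≫ (kernelDiskIso _).hom)
    exact mono_of_mono_fac hg
  have hfac := factorsThroughInjectives_of_path hC φ fun Δ hΔ => hpath hC Δ hΔ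
  obtain ⟨T, hT, hTm, hmax⟩ := exists_maximal_injective_subobject hI (cokernel.π φ)
  let ρ : kernel (C.d 0 (-1)) ⟶ (T : 𝒜) :=
    cokernel.π φ ≫ Injective.factorThru (𝟙 _) (T.arrow ≫ cokernel.π φ)
  have hTρ : T.arrow ≫ ρ = 𝟙 _ := by
    rw [← Category.assoc]
    exact Injective.comp_factorThru _ _
  have hφρ : φ ≫ ρ = 0 := by simp [ρ]
  let a : C.X 0 ⟶ (T : 𝒜) := Injective.factorThru ρ (kernel.ι _)
  have ha : kernel.ι _ ≫ a = ρ := Injective.comp_factorThru _ _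
  obtain ⟨s, hs⟩ := hC.lift _ hT (0 + 1) 0 (-1) rfl (by lia) (T.arrow ≫ kernel.ι _) (by simp)
  have hsp : diskHomEquiv.symm s ≫ toDisk a = 𝟙 _ :=
    diskHomEquiv_symm_comp_toDisk a s (by rw [reassoc_of% hs, ha, hTρ])
  let R : Retract (kernel (toDisk a)) C :=
    { i := kernel.ι _
      r := kernel.lift _ (𝟙 C - toDisk a ≫ diskHomEquiv.symm s) (by
        rw [Preadditive.sub_comp, Category.assoc, hsp]; simp)
      retract := by
        rw [← cancel_mono (kernel.ι _)]
        simp [Preadditive.comp_sub] }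
  have hRri : R.r ≫ R.i = 𝟙 C - toDisk a ≫ diskHomEquiv.symm s := kernel.lift_ι _ _ _
  let r : Retract (kernel ((kernel (toDisk a)).d 0 (-1))) (kernel (C.d 0 (-1))) :=
    { i := zeroCyclesMap R.i
      r := zeroCyclesMap R.r
      retract := by
        rw [← zeroCyclesMap_comp, R.retract, ← cancel_mono (kernel.ι _)]
        simp }
  have hri : r.r ≫ r.i = 𝟙 _ - ρ ≫ T.arrow := by
    change zeroCyclesMap R.r ≫ zeroCyclesMap R.i = _
    rw [← zeroCyclesMap_comp, hRri, ← cancel_mono (kernel.ι _), zeroCyclesMap_ι,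
      HomologicalComplex.sub_f_apply, toDisk_comp_f, hs, HomologicalComplex.id_f,
      Preadditive.comp_sub, reassoc_of% ha, Preadditive.sub_comp]
    simp
  have hφr : φ ≫ r.r ≫ r.i = φ := by
    rw [hri, Preadditive.comp_sub, reassoc_of% hφρ]; simp
  have hTr : T.arrow ≫ r.r = 0 := by
    have : Mono r.i := mono_of_mono_fac r.retract
    rw [← cancel_mono r.i, Category.assoc, hri, Preadditive.comp_sub, reassoc_of% hTρ]; simp
  have hm : Mono (φ ≫ r.r) := by
    have : Mono ((φ ≫ r.r) ≫ r.i) := by rw [Category.assoc, hφr]; exact hφ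
    exact mono_of_mono _ r.i
  refine ⟨_, φ ≫ r.r, ⟨?_, fun G' hG' ψ => ?_⟩, fun f hf => ?_⟩
  · exact isGorensteinInjective_iff.2 ⟨_, hC.of_retract hP R, ⟨Iso.refl _⟩⟩
  · obtain ⟨D, hD, ⟨e⟩⟩ := isGorensteinInjective_iff.1 hG'
    obtain ⟨g, hg⟩ := hext hD (ψ ≫ e.hom)
    refine ⟨r.i ≫ g ≫ e.inv, ?_⟩
    rw [Category.assoc, reassoc_of% hφr, reassoc_of% hg, e.hom_inv_id, Category.comp_id]
  · exact isIso_of_factorsThroughInjectives (hfac.of_retract r hφr)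
      (HasNoDisjointInjectives.of_retract r T.arrow hTm hTr hmax) hf
end Reduction

section ProjectiveSeparator
variable {𝒜 : Type u} [Category.{v} 𝒜] [Abelian 𝒜]
open HomologicalComplex

lemma projective_evalCompCoyonedaCorepresentative {ι : Type w} (c : ComplexShape ι) [c.HasNoLoop]
    (G : 𝒜) [Projective G] (j : ι) : Projective (evalCompCoyonedaCorepresentative c G j) where
  factors {E K} f e _ := by
    have H := evalCompCoyonedaCorepresentable c G j
    have : Epi (e.f j) := inferInstanceAs (Epi ((eval 𝒜 c j).map e))
    let a : G ⟶ K.X j := H.homEquiv (Y := K) f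
    obtain ⟨b, hb⟩ : ∃ b : G ⟶ E.X j, b ≫ e.f j = a := Projective.factors a (e.f j)
    refine ⟨H.homEquiv.symm b, ?_⟩
    apply H.homEquiv.injective
    refine (H.homEquiv_comp _ _).trans ?_
    refine (congrArg _ (H.homEquiv.apply_symm_apply b)).trans ?_
    exact hb

lemma projective_sigma {ℬ : Type*} [Category* ℬ] {ι : Type*} (g : ι → ℬ) [HasCoproduct g]
    (h : ∀ i, Projective (g i)) : Projective (∐ g) :=
  ⟨fun f e _ => ⟨Sigma.desc fun i => Projective.factorThru (Sigma.ι _ i ≫ f) e,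
    Sigma.hom_ext _ _ fun i => by simp⟩⟩

lemma exists_projective_separator_homologicalComplex {ι : Type w} (c : ComplexShape ι)
    [c.HasNoLoop] [HasCoproductsOfShape ι 𝒜] {G : 𝒜} [Projective G] (hG : IsSeparator G) :
    ∃ P : HomologicalComplex 𝒜 c, Projective P ∧ IsSeparator P := by
  have hP (i : ι) : Projective (separatingFamily c (fun _ : Unit => G) ⟨⟨⟩, i⟩) :=
    projective_evalCompCoyonedaCorepresentative c G i
  exact ⟨_, projective_sigma _ hP, isSeparator_coproduct_separatingFamily c hG⟩
end ProjectiveSeparator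

section InjectiveComplexes
variable {𝒜 : Type u} [Category.{v} 𝒜] [Abelian 𝒜]
open HomologicalComplex

lemma exists_splitting_of_injective_cycles {K : ChainComplex 𝒜 ℤ} (hK : ∀ n, K.ExactAt n) (n : ℤ)
    (h : Injective (kernel (K.d n (n - 1)))) :
    ∃ (r : K.X n ⟶ kernel (K.d n (n - 1))) (s : kernel (K.d (n - 1) (n - 1 - 1)) ⟶ K.X n),
      s ≫ K.d n (n - 1) = kernel.ι _ ∧
      kernel.lift _ (K.d n (n - 1)) (K.d_comp_d _ _ _) ≫ s = 𝟙 _ - r ≫ kernel.ι _ ∧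
      kernel.ι _ ≫ r = 𝟙 _ := by
  let r : K.X n ⟶ kernel (K.d n (n - 1)) := Injective.factorThru (𝟙 _) (kernel.ι _)
  have hr : kernel.ι _ ≫ r = 𝟙 _ := Injective.comp_factorThru _ _
  let d' : K.X n ⟶ kernel (K.d (n - 1) (n - 1 - 1)) := kernel.lift _ (K.d n (n - 1)) (by simp)
  have hd' : d' ≫ kernel.ι _ = K.d n (n - 1) := kernel.lift_ι _ _ _
  have hepi : Epi d' := by
    have := (exactAt_iff_of_succ K (i := n) (j := n - 1) (k := n - 1 - 1) (by lia) (by lia)).1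
      (hK _)
    exact ((K.sc' n (n - 1) (n - 1 - 1)).exact_iff_epi_kernel_lift).1 this
  have h0 : kernel.ι d' ≫ (𝟙 _ - r ≫ kernel.ι (K.d n (n - 1))) = 0 := by
    have : kernel.ι d' = kernel.lift (K.d n (n - 1)) (kernel.ι d') (by
      rw [← hd', kernel.condition_assoc, zero_comp]) ≫ kernel.ι _ := by simp
    rw [this, Category.assoc, Preadditive.comp_sub, reassoc_of% hr]
    simp
  refine ⟨r, Abelian.epiDesc d' _ h0, ?_, Abelian.comp_epiDesc d' _ h0, hr⟩
  rw [← cancel_epi d', reassoc_of% Abelian.comp_epiDesc d' _ h0, hd', Preadditive.sub_comp]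
  simp

lemma injective_of_exact_of_injective_cycles {K : ChainComplex 𝒜 ℤ} (hK : ∀ n, K.ExactAt n)
    (h : ∀ n, Injective (kernel (K.d n (n - 1)))) : Injective K where
  factors {A B} f i hi := by
    choose r s hs hrs hr using fun n => exists_splitting_of_injective_cycles hK n (h n)
    let b (n) : B.X n ⟶ kernel (K.d n (n - 1)) := Injective.factorThru (f.f n ≫ r n) (i.f n)
    have hb (n) : i.f n ≫ b n = f.f n ≫ r n := Injective.comp_factorThru _ _
    refine ⟨{ f := fun n => b n ≫ kernel.ι _ + B.d n (n - 1) ≫ b (n - 1) ≫ s n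
              comm' := ?_ }, ?_⟩
    · intro i j hij
      obtain rfl : j = i - 1 := by simp at hij; lia
      simp [hs]
    · ext n
      have h1 : K.d n (n - 1) ≫ r (n - 1) = kernel.lift _ (K.d n (n - 1)) (K.d_comp_d _ _ _) := by
        conv_lhs => rw [← kernel.lift_ι (K.d (n - 1) (n - 1 - 1)) (K.d n (n - 1)) (by simp)]
        rw [Category.assoc, hr, Category.comp_id]
      simp [reassoc_of% hb, ← f.comm_assoc, reassoc_of% h1, hrs]
end InjectiveComplexes

section BaerCriterion
variable {𝒜 : Type u} [Category.{v} 𝒜] [Abelian 𝒜]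
open HomologicalComplex

/-- A Baer-type criterion: a morphism from a subobject of `G` to the cycles of `K` extends to `G`,
up to the differential. -/
def ExtendsToBoundaries (G : 𝒜) (K : ChainComplex 𝒜 ℤ) : Prop :=
  ∀ (n : ℤ) (S : Subobject G) (f : (S : 𝒜) ⟶ K.X n), f ≫ K.d n (n - 1) = 0 →
    ∃ y : G ⟶ K.X (n + 1), S.arrow ≫ y ≫ K.d (n + 1) n = f

lemma extendsToBoundaries_of_injective (G : 𝒜) (K : ChainComplex 𝒜 ℤ) [Injective K] :
    ExtendsToBoundaries G K := by
  intro n S f hf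
  let a : sphereComplex n (S : 𝒜) ⟶ K := mkHomFromSingle f (by
    intro k hk
    obtain rfl : k = n - 1 := by simp at hk; lia
    exact hf)
  have := mono_sphereToDisk n G
  let i : sphereComplex n (S : 𝒜) ⟶ diskComplex n G :=
    (single 𝒜 (ComplexShape.down ℤ) n).map S.arrow ≫ sphereToDisk n G
  obtain ⟨b, hb⟩ := Injective.factors a i
  refine ⟨diskHomEquiv b, ?_⟩
  have h := congr_hom hb n
  rw [← sphereToDisk_comp_f, ← cancel_epi (singleObjXSelf (ComplexShape.down ℤ) n (S : 𝒜)).hom]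
  simpa [a, i, single_map_f_self] using h

lemma injective_of_extendsToBoundaries [IsGrothendieckAbelian.{v} 𝒜] {G : 𝒜} (hG : IsSeparator G)
    {K : ChainComplex 𝒜 ℤ} (hK : ExtendsToBoundaries G K) : Injective K := by
  have hex (n) : K.ExactAt n := by
    refine exactAt_of_liftsCycles hG ?_ n
    rintro _ j k rfl hjk f hf
    obtain rfl : k = j - 1 := by lia
    obtain ⟨y, hy⟩ := hK j ⊤ ((⊤ : Subobject G).arrow ≫ f) (by rw [Category.assoc, hf, comp_zero])
    exact ⟨y, (cancel_epi _).1 hy⟩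
  refine injective_of_exact_of_injective_cycles hex fun n => ?_
  rw [injective_iff_rlp_monomorphisms_zero, ← IsGrothendieckAbelian.generatingMonomorphisms_rlp hG]
  rintro _ _ _ ⟨S⟩
  refine ⟨fun {a b} sq => ?_⟩
  obtain ⟨y, hy⟩ := hK n S (a ≫ kernel.ι _) (by simp)
  refine ⟨⟨⟨kernel.lift _ (y ≫ K.d (n + 1) n) (by simp), ?_, (isZero_zero 𝒜).eq_of_tgt _ _⟩⟩⟩
  rw [← cancel_mono (kernel.ι _)]
  simpa using hy
end BaerCriterion

section Modules
open HomologicalComplex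

lemma exists_fac_of_finite {R : Type u} [Ring R] {J : Type u} [SmallCategory J] [IsFiltered J]
    {F : J ⥤ ModuleCat.{u} R} {c : Cocone F} (hc : IsColimit c) (hι : ∀ j, Mono (c.ι.app j))
    {M : ModuleCat.{u} R} [Module.Finite R M] (f : M ⟶ c.pt) :
    ∃ (j : J) (g : M ⟶ F.obj j), g ≫ c.ι.app j = f := by
  classical
  obtain ⟨s, hs⟩ := Module.Finite.fg_top (R := R) (M := M)
  choose j x hx using fun m : M => Concrete.isColimit_exists_rep F hc (f m)
  obtain ⟨k, hk⟩ := IsFiltered.sup_objs_exists (s.image j)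
  have hle : LinearMap.range f.hom ≤ LinearMap.range (c.ι.app k).hom := by
    rw [LinearMap.range_eq_map, ← hs, Submodule.map_span_le]
    intro m hm
    obtain ⟨a⟩ := hk (Finset.mem_image_of_mem j hm)
    exact ⟨F.map a (x m), by rw [← hx m, ← c.w a]; rfl⟩
  have hinj : Function.Injective (c.ι.app k).hom := (ModuleCat.mono_iff_injective _).1 (hι k)
  let e := LinearEquiv.ofInjective _ hinj
  refine ⟨k, ModuleCat.ofHom (e.symm.toLinearMap ∘ₗ
    f.hom.codRestrict _ fun m => hle ⟨m, rfl⟩), ?_⟩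
  ext m
  exact congrArg Subtype.val (e.apply_symm_apply ⟨f.hom m, hle ⟨m, rfl⟩⟩)

lemma hasInjectiveChainUnions_chainComplex_moduleCat (R : Type u) [CommRing R]
    [IsNoetherianRing R] : HasInjectiveChainUnions (ChainComplex (ModuleCat.{u} R) ℤ) := by
  intro E c hc hne hinj
  obtain ⟨J, _, _, F, s, hs, e, he⟩ := exists_isColimit_of_isChain hc hne
  have hFinj (j) : Injective (F.obj j) := by
    obtain ⟨S, hS, i, -⟩ := he j
    have := hinj S hS
    exact Injective.of_iso i.symm this
  have hmono (j) : Mono (s.ι.app j) := by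
    obtain ⟨S, hS, i, hi⟩ := he j
    have : Mono (s.ι.app j ≫ e.hom ≫ (sSup c).arrow) := by rw [hi]; infer_instance
    exact mono_of_mono _ (e.hom ≫ (sSup c).arrow)
  refine Injective.of_iso e (injective_of_extendsToBoundaries (ModuleCat.isSeparator R) ?_)
  intro n S f hf
  have : IsNoetherian R (Shrink.{u} R) := isNoetherian_of_linearEquiv (Shrink.linearEquiv R R).symm
  have : Module.Finite R (S : ModuleCat.{u} R) :=
    Module.Finite.of_injective S.arrow.hom ((ModuleCat.mono_iff_injective _).1 inferInstance)
  obtain ⟨j, g, rfl⟩ : ∃ (j : J) (g : (S : ModuleCat.{u} R) ⟶ (F.obj j).X n),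
      g ≫ (s.ι.app j).f n = f :=
    exists_fac_of_finite (isColimitOfPreserves (eval _ _ n) hs)
      (fun j => inferInstanceAs (Mono ((s.ι.app j).f n))) f
  obtain ⟨y, hy⟩ := extendsToBoundaries_of_injective (ModuleCat.of R (Shrink.{u} R)) (F.obj j) n S g
    (by
      rw [← cancel_mono ((s.ι.app j).f (n - 1)), Category.assoc, ← (s.ι.app j).comm, zero_comp,
        ← hf, Category.assoc]
      rfl)
  refine ⟨y ≫ (s.ι.app j).f (n + 1), ?_⟩
  have h := (s.ι.app j).comm (n + 1) n
  dsimp only [Functor.const_obj_obj] at h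
  rw [← hy, Category.assoc, Category.assoc, Category.assoc, h]
end Modules

/-- Let `R` be a commutative noetherian ring such that the character module
of every Gorenstein injective `R`-module is Gorenstein flat.  Then the class of Gorenstein
injective complexes is enveloping in `Ch(R)`. -/
theorem gorensteinInjective_complexes_enveloping_of_character_gorensteinFlat
    (R : Type u) [CommRing R] [IsNoetherianRing R]
    (hchar : ∀ M : ModuleCat.{u} R, IsGorensteinInjective M →
      IsGorensteinFlat R (ModuleCat.of R (CharacterModule M))) :
    ∀ X : ChainComplex (ModuleCat.{u} R) ℤ, ∃ (G : ChainComplex (ModuleCat.{u} R) ℤ)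
      (ψ : X ⟶ G), IsEnvelope (fun K => IsGorensteinInjective K) ψ := by
  have : Projective (ModuleCat.of R (Shrink.{u} R)) :=
    ModuleCat.projective_of_free (Module.Free.chooseBasis R _)
  obtain ⟨P, hP, hP'⟩ := exists_projective_separator_homologicalComplex (ComplexShape.down ℤ)
    (ModuleCat.isSeparator R)
  exact fun X => exists_isEnvelope_isGorensteinInjective
    (hasInjectiveChainUnions_chainComplex_moduleCat R) hP' X
end

section
/- If R is a commutative noetherian ring with a dualizing complex, then every unbounded chain complex of R-modules has a Gorenstein injective envelope. -/
open CategoryTheory CategoryTheory.Limits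

universe u

section Dualizing

open ZeroObject

variable (R : Type u) [CommRing R]

/-- A dualizing complex for a commutative noetherian ring `R`: a bounded complex `D` of
injective `R`-modules whose cohomology modules are finitely generated, and such that the
canonical map `R ⟶ RHom(D, D)` is a quasi-isomorphism.  Since `D` is a bounded complex of
injectives, the latter condition says exactly that `H^n(Hom•(D,D)) = 0` for `n ≠ 0` (every
chain map `D ⟶ D⟦n⟧` is null-homotopic) and that `H^0(Hom•(D,D)) = Hom_{K(R)}(D,D)` is, via
the canonical map, a free `R`-module generated by the identity (every chain self-map of `D` is
homotopic to `r • 𝟙 D` for a unique `r : R`). -/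
def IsDualizingComplex (D : CochainComplex (ModuleCat.{u} R) ℤ) : Prop :=
  (∀ n, Injective (D.X n)) ∧
  (∃ a b : ℤ, ∀ n, (n < a ∨ b < n) → IsZero (D.X n)) ∧
  (∀ n, Module.Finite R (D.homology n)) ∧
  (∀ f : D ⟶ D, ∃! r : R, Nonempty (Homotopy f (r • 𝟙 D))) ∧
  (∀ n : ℤ, n ≠ 0 → ∀ f : D ⟶ D⟦n⟧, Nonempty (Homotopy f 0))

end Dualizing

universe v w

namespace GorensteinEnvelope

section Chains

lemma isFiltered_of_isChain {P : Type*} [PartialOrder P] {c : Set P} {J : Type*} [PartialOrder J]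
    (e : J ≃o c) (hc : IsChain (· ≤ ·) c) (hne : c.Nonempty) : IsFiltered J := by
  have : Nonempty J := ⟨e.symm ⟨_, hne.choose_spec⟩⟩
  have : IsDirected J (· ≤ ·) := ⟨fun i j => by
    rcases hc.total (e i).2 (e j).2 with h | h
    · exact ⟨j, e.le_iff_le.1 h, le_rfl⟩
    · exact ⟨i, le_rfl, e.le_iff_le.1 h⟩⟩
  infer_instance

variable {A : Type w} [Category.{v} A] [Abelian A] [IsGrothendieckAbelian.{v} A]

attribute [local instance] IsFiltered.isConnected

variable {Y : A} {c : Set (Subobject Y)} {J : Type v} [PartialOrder J] (e : J ≃o c)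

/-- The diagram of subobjects attached to a set of subobjects, indexed by a small category. -/
noncomputable def diagram : J ⥤ MonoOver Y :=
  (show Monotone (fun j => (e j : Subobject Y)) from
    fun _ _ h => e.monotone h).functor ⋙ Subobject.representative

/-- The cocone on `diagram e` whose point is the supremum of `c`. -/
noncomputable def supCocone : Cocone (diagram e ⋙ MonoOver.forget Y) where
  pt := Over.mk (sSup c).arrow
  ι :=
    { app j := Over.homMk (Subobject.ofLE _ _ (le_sSup (e j).2))
        (Subobject.ofLE_arrow _)
      naturality _ _ _ := Over.OverMorphism.ext
        ((Subobject.ofLE_comp_ofLE _ _ _ _ _).trans (Category.comp_id _).symm) }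

lemma iSup_diagram : ⨆ j, Subobject.mk ((diagram e).obj j).obj.hom = sSup c := by
  have h (j) : Subobject.mk ((diagram e).obj j).obj.hom = (e j : Subobject Y) :=
    Subobject.mk_arrow _
  simp_rw [h]
  rw [sSup_eq_iSup']
  exact e.toEquiv.iSup_congr (fun _ => rfl)

/-- The supremum of a nonempty chain of subobjects is their colimit. -/
noncomputable def isColimitSupCocone (hc : IsChain (· ≤ ·) c) (hne : c.Nonempty) :
    IsColimit ((Over.forget Y).mapCocone (supCocone e)) := by
  have := isFiltered_of_isChain e hc hne
  have : Mono (supCocone e).pt.hom := inferInstanceAs (Mono (sSup c).arrow)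
  exact IsGrothendieckAbelian.isColimitMapCoconeOfSubobjectMkEqISup (diagram e) _
    ((Subobject.mk_arrow _).trans (iSup_diagram e).symm)

omit e in
lemma mono_sSup_arrow_comp {Z : A} (q : Y ⟶ Z)
    (hc : IsChain (· ≤ ·) c) (hne : c.Nonempty) (h : ∀ K ∈ c, Mono (K.arrow ≫ q)) :
    Mono ((sSup c).arrow ≫ q) := by
  let e := (orderIsoShrink.{v} c).symm
  have := isFiltered_of_isChain e hc hne
  let α : (diagram e ⋙ MonoOver.forget Y) ⋙ Over.forget Y ⟶ (Functor.const _).obj Z :=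
    { app j := (e j : Subobject Y).arrow ≫ q
      naturality _ _ _ := by
        refine Eq.trans ?_ (Category.comp_id _).symm
        exact (Category.assoc _ _ _).symm.trans (congrArg (· ≫ q) (Subobject.ofLE_arrow _)) }
  have : ∀ j, Mono (α.app j) := fun j => h _ (e j).2
  have := NatTrans.mono_of_mono_app α
  exact colim.map_mono' α (isColimitSupCocone e hc hne) (isColimitConstCocone _ Z) _ (fun j =>
    ((Category.assoc _ _ _).symm.trans
      (congrArg (· ≫ q) (Subobject.ofLE_arrow _))).trans (Category.comp_id _).symm)

include e in
open IsGrothendieckAbelian.IsPresentable.surjectivity in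
lemma exists_factor_of_noetherian_of_orderIso {N : A} [IsNoetherianObject N]
    (hc : IsChain (· ≤ ·) c) (hne : c.Nonempty) (z : N ⟶ (sSup c : Subobject Y)) :
    ∃ (K : Subobject Y) (hK : K ∈ c) (y : N ⟶ K), y ≫ K.ofLE _ (le_sSup hK) = z := by
  have := isFiltered_of_isChain e hc hne
  let cc := (Over.forget Y).mapCocone (supCocone e)
  have hcc : IsColimit cc := isColimitSupCocone e hc hne
  have : ∀ j, Mono (cc.ι.app j) := fun j => inferInstanceAs (Mono (Subobject.ofLE _ _ (le_sSup (e j).2)))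
  have : Mono cc.ι := NatTrans.mono_of_mono_app _
  let G := F (c := cc) z
  let K : Cocone (G ⋙ MonoOver.forget N ⋙ Over.forget N) :=
    colimit.cocone (pullback cc.ι ((Functor.const _).map z))
  have hK : IsColimit K := colimit.isColimit (pullback cc.ι ((Functor.const _).map z))
  let k : K.pt ⟶ N := f (c := cc) z
  have hG : ∀ j, K.ι.app j ≫ k = (G.obj j).obj.hom := hf (c := cc) z
  have : Mono k := IsGrothendieckAbelian.mono_of_isColimit_monoOver G hK k hG
  have h1 : Subobject.mk k = _ :=
    IsGrothendieckAbelian.subobjectMk_of_isColimit_eq_iSup G hK k hG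
  have h2 : Epi k := epi_f hcc z
  rw [Subobject.epi_iff_mk_eq_top, h1] at h2
  obtain ⟨m, ⟨j, rfl⟩, hj⟩ := WellFounded.has_min
    (wellFounded_gt (α := Subobject N))
    (Set.range fun j => Subobject.mk (G.obj j).obj.hom)
    (by have := IsFiltered.nonempty (C := J); exact Set.range_nonempty _)
  have h3 : Subobject.mk (G.obj j).obj.hom = ⊤ := by
    rw [← top_le_iff, ← h2, iSup_le_iff]
    intro i
    have hi := MonoOver.subobjectMk_le_mk_of_hom (G.map (IsFiltered.leftToMax i j))
    have hj' := MonoOver.subobjectMk_le_mk_of_hom (G.map (IsFiltered.rightToMax i j))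
    refine hi.trans (not_lt_iff_le_imp_ge.1 (hj _ ⟨_, rfl⟩) hj')
  rw [← Subobject.isIso_iff_mk_eq_top] at h3
  refine ⟨_, (e j).2,
    inv (G.obj j).obj.hom ≫ (pullback.fst cc.ι _).app j, ?_⟩
  exact (Category.assoc _ _ _).trans ((IsIso.inv_comp_eq _).2 (NatTrans.congr_app
    (pullback.condition (f := cc.ι) (g := (Functor.const _).map z)) j))

omit e in
lemma exists_factor_of_noetherian {N : A} [IsNoetherianObject N]
    (hc : IsChain (· ≤ ·) c) (hne : c.Nonempty) (z : N ⟶ (sSup c : Subobject Y)) :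
    ∃ (K : Subobject Y) (hK : K ∈ c) (y : N ⟶ K), y ≫ K.ofLE _ (le_sSup hK) = z :=
  exists_factor_of_noetherian_of_orderIso (orderIsoShrink.{v} c).symm hc hne z

end Chains

section Hulls

variable {A : Type w} [Category.{v} A] [Abelian A]

/-- A monomorphism `ε` is essential if any morphism `g` such that `ε ≫ g` is mono is mono. -/
structure IsEssential {X Y : A} (ε : X ⟶ Y) : Prop where
  mono : Mono ε
  mono_of_mono_comp : ∀ {Z : A} (g : Y ⟶ Z), Mono (ε ≫ g) → Mono g

lemma mono_of_comp_eq_zero {X Y : A} {f : X ⟶ Y} (h : ∀ (W : A) (x : W ⟶ X), x ≫ f = 0 → x = 0) :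
    Mono f :=
  Preadditive.mono_of_cancel_zero f (fun {_} x hx => h _ x hx)

lemma exists_refinement_of_comp_cokernel_eq_zero {X Y W : A} (f : X ⟶ Y) (y : W ⟶ Y)
    (hy : y ≫ cokernel.π f = 0) :
    ∃ (W' : A) (π : W' ⟶ W) (_ : Epi π) (x : W' ⟶ X), π ≫ y = x ≫ f :=
  (ShortComplex.exact_cokernel f).exact_up_to_refinements y hy

section

variable [IsGrothendieckAbelian.{v} A]

lemma exists_maximal_subobject {Y Z : A} (q : Y ⟶ Z) (P : Subobject Y → Prop)
    (hP : ∀ c : Set (Subobject Y), (∀ K ∈ c, P K) → IsChain (· ≤ ·) c → c.Nonempty → P (sSup c))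
    (K₀ : Subobject Y) (h₀ : P K₀) (h₀' : Mono (K₀.arrow ≫ q)) :
    ∃ K, K₀ ≤ K ∧ P K ∧ Mono (K.arrow ≫ q) ∧
      ∀ L, P L → Mono (L.arrow ≫ q) → K ≤ L → L = K := by
  obtain ⟨K, hK, hmax⟩ := zorn_le_nonempty₀ {K | P K ∧ Mono (K.arrow ≫ q)}
    (fun c hc hchain y hy => ⟨sSup c, ⟨hP c (fun K hK => (hc hK).1) hchain ⟨y, hy⟩,
      mono_sSup_arrow_comp q hchain ⟨y, hy⟩ (fun K hK => (hc hK).2)⟩, fun z hz => le_sSup hz⟩)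
    K₀ ⟨h₀, h₀'⟩
  exact ⟨K, hK, hmax.prop.1, hmax.prop.2, fun L h1 h2 h3 => hmax.eq_of_ge ⟨h1, h2⟩ h3⟩

lemma mono_bot_arrow_comp {Y Z : A} (q : Y ⟶ Z) : Mono ((⊥ : Subobject Y).arrow ≫ q) :=
  mono_of_comp_eq_zero fun _ x _ => by
    rw [← cancel_mono (⊥ : Subobject Y).arrow, Subobject.bot_arrow, comp_zero, comp_zero]

lemma exists_epi_isEssential {E Y : A} (ι : E ⟶ Y) [Mono ι] :
    ∃ (Q : A) (π : Y ⟶ Q), Epi π ∧ IsEssential (ι ≫ π) := by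
  obtain ⟨K, -, -, hK, hmax⟩ := exists_maximal_subobject (cokernel.π ι) (fun _ => True)
    (fun _ _ _ _ => trivial) ⊥ trivial (mono_bot_arrow_comp _)
  refine ⟨_, cokernel.π K.arrow, inferInstance, mono_of_comp_eq_zero fun W x hx => ?_,
    fun {Z} v hv => ?_⟩
  · rw [← Category.assoc] at hx
    have hy := Abelian.monoLift_comp K.arrow (x ≫ ι) hx
    have : Abelian.monoLift K.arrow (x ≫ ι) hx = 0 := by
      rw [← cancel_mono (K.arrow ≫ cokernel.π ι), zero_comp, reassoc_of% hy, cokernel.condition,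
        comp_zero]
    rwa [this, zero_comp, eq_comm, ← zero_comp (f := ι), cancel_mono] at hy
  · let L := kernelSubobject (cokernel.π K.arrow ≫ v)
    have hL : L.arrow ≫ cokernel.π K.arrow ≫ v = 0 := kernelSubobject_arrow_comp _
    have hKL : K ≤ L := le_kernelSubobject _ _ (by simp)
    have : Mono (L.arrow ≫ cokernel.π ι) := mono_of_comp_eq_zero fun W x hx => by
      rw [← Category.assoc] at hx
      have hy := Abelian.monoLift_comp ι (x ≫ L.arrow) hx
      have h0 : Abelian.monoLift ι (x ≫ L.arrow) hx = 0 := by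
        rw [← cancel_mono ((ι ≫ cokernel.π K.arrow) ≫ v), zero_comp]
        simp only [Category.assoc]
        rw [reassoc_of% hy, hL, comp_zero]
      rwa [h0, zero_comp, eq_comm, ← zero_comp (f := L.arrow), cancel_mono] at hy
    have hLK := hmax L trivial this hKL
    refine mono_of_comp_eq_zero fun W x hx => ?_
    obtain ⟨W', p, _, y, hy⟩ := surjective_up_to_refinements_of_epi (cokernel.π K.arrow) x
    have hy' : L.Factors y := (kernelSubobject_factors_iff _ _).2 (by
      rw [← reassoc_of% hy, hx, comp_zero])
    rw [hLK] at hy'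
    rw [← cancel_epi p, hy, ← K.factorThru_arrow y hy', Category.assoc, cokernel.condition,
      comp_zero, comp_zero]

variable {σ : Type v} {M : σ → A}
  (hM : ∀ ⦃X Y : A⦄ (f : X ⟶ Y), (∀ s (m : M s ⟶ X), m ≫ f = 0) → f = 0)

include hM

/-- Baer's criterion for a separating family. -/
lemma injective_of_baer (E : A)
    (hE : ∀ (s : σ) (N : A) (n : N ⟶ M s) [Mono n] (f : N ⟶ E), ∃ e : M s ⟶ E, n ≫ e = f) :
    Injective E := by
  obtain ⟨Q, π, -, hε⟩ := exists_epi_isEssential (Injective.ι E)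
  set ε := Injective.ι E ≫ π with hε'
  have := hε.mono
  have hepi : Epi ε := by
    refine Preadditive.epi_of_cokernel_zero (hM _ fun s m => ?_)
    obtain ⟨e, he⟩ := hE s _ (pullback.fst m ε) (pullback.snd m ε)
    let u := m - e ≫ ε
    have hu : pullback.fst m ε ≫ u = 0 := by
      rw [Preadditive.comp_sub, reassoc_of% he, pullback.condition, sub_self]
    have : Mono (cokernel.π u) := hε.mono_of_mono_comp _ (mono_of_comp_eq_zero fun W x hx => by
      rw [← Category.assoc] at hx
      obtain ⟨W', p, _, y, hy⟩ := exists_refinement_of_comp_cokernel_eq_zero _ _ hx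
      have hl : y ≫ m = (p ≫ x + y ≫ e) ≫ ε := by
        simp only [u, Preadditive.comp_sub] at hy
        simp [hy]
      rw [← pullback.lift_fst y _ hl, Category.assoc, hu, comp_zero, ← Category.assoc,
        ← zero_comp (f := ε), cancel_mono, ← comp_zero (f := p), cancel_epi] at hy
      exact hy)
    have hu0 : u = 0 := by
      rw [← cancel_mono (cokernel.π u), cokernel.condition, zero_comp]
    rw [sub_eq_zero.1 hu0, Category.assoc, cokernel.condition, comp_zero]
  have : IsIso ε := isIso_of_mono_of_epi ε
  have r : Retract E (Injective.under E) :=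
    { i := Injective.ι E
      r := π ≫ inv ε
      retract := by rw [← Category.assoc, ← hε', IsIso.hom_inv_id] }
  exact r.injective

variable (hN : ∀ s, IsNoetherianObject (M s))
include hN

lemma injective_sSup {Y : A} (c : Set (Subobject Y)) (hc : ∀ K ∈ c, Injective (K : A))
    (hchain : IsChain (· ≤ ·) c) (hne : c.Nonempty) : Injective ((sSup c : Subobject Y) : A) := by
  refine injective_of_baer hM _ fun s N n _ f => ?_
  have := hN s
  have := isNoetherianObject_of_mono n
  obtain ⟨K, hK, y, hy⟩ := exists_factor_of_noetherian hchain hne f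
  have := hc K hK
  exact ⟨Injective.factorThru y n ≫ K.ofLE _ (le_sSup hK), by
    rw [← Category.assoc, Injective.comp_factorThru, hy]⟩

lemma exists_maximal_injective {Y Z : A} (q : Y ⟶ Z) :
    ∃ (I : A) (i : I ⟶ Y), Injective I ∧ Mono (i ≫ q) ∧ 
      ∀ (I' : A) (j : I' ⟶ Y) (_ : Injective I') (_ : Mono (j ≫ q)) (t : I ⟶ I'),
        t ≫ j = i → IsIso t := by
  have : Injective ((⊥ : Subobject Y) : A) :=
    (((isZero_zero A).of_iso (Subobject.botCoeIsoZero)).injective)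
  obtain ⟨K, -, hI, hK, hmax⟩ := exists_maximal_subobject q
    (fun K => Injective (K : A)) (injective_sSup hM hN) ⊥ this (mono_bot_arrow_comp _)
  refine ⟨K, K.arrow, hI, hK, fun I' j hI' hj t ht => ?_⟩
  have : Mono j := mono_of_mono j q
  have h := hmax (Subobject.mk j) (Injective.of_iso (Subobject.underlyingIso j).symm hI') (by
    rw [← Subobject.underlyingIso_hom_comp_eq_mk, Category.assoc]; infer_instance)
    (Subobject.le_mk_of_comm t ht)
  have hle : Subobject.mk j ≤ K := h.le
  refine ⟨Subobject.ofMkLE j K hle, ?_, ?_⟩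
  · rw [← cancel_mono K.arrow]; simp [ht]
  · rw [← cancel_mono j]; simp [ht]

end

/-- Injective objects containing `N` contain a hull of `N`. -/
lemma exists_hull [IsGrothendieckAbelian.{v} A] {N I : A} (n : N ⟶ I) [Mono n] [Injective I] :
    ∃ (J : A) (a : N ⟶ J) (b : J ⟶ I), Injective J ∧ IsEssential a ∧ a ≫ b = n := by
  obtain ⟨Q, π, _, hε⟩ := exists_epi_isEssential n
  have := hε.mono
  obtain ⟨J, hJ, -, hJπ, hmax⟩ := exists_maximal_subobject π (fun _ => True)
    (fun _ _ _ _ => trivial) (Subobject.mk n) trivial (by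
      rw [← Subobject.underlyingIso_hom_comp_eq_mk, Category.assoc]; infer_instance)
  let g : Q ⟶ I := Injective.factorThru J.arrow (J.arrow ≫ π)
  have hg : (J.arrow ≫ π) ≫ g = J.arrow := Injective.comp_factorThru _ _
  let n' := Subobject.ofMkLE n J hJ
  have hn' : n' ≫ J.arrow = n := Subobject.ofMkLE_arrow _
  have hag : (n ≫ π) ≫ g = n := by
    rw [← hn']; simp only [Category.assoc] at hg ⊢; rw [hg]
  have : Mono g := hε.mono_of_mono_comp g (by rw [hag]; infer_instance)
  have hnd : Mono (g ≫ π) := hε.mono_of_mono_comp _ (by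
    rw [← Category.assoc, hag]; infer_instance)
  have hle : J ≤ Subobject.mk g := Subobject.le_mk_of_comm _ hg
  have hgJ := hmax (Subobject.mk g) trivial (by
      rw [← Subobject.underlyingIso_hom_comp_eq_mk, Category.assoc]; infer_instance) hle
  let t := Subobject.ofMkLE g J hgJ.le
  have ht : t ≫ J.arrow = g := Subobject.ofMkLE_arrow _
  have : g ≫ π = 𝟙 Q := by
    rw [← cancel_mono g, Category.id_comp, ← ht]
    simp only [Category.assoc] at hg ⊢
    rw [ht, hg, ht]
  exact ⟨Q, n ≫ π, g, Retract.injective ⟨g, π, this⟩, hε, hag⟩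

end Hulls

section TotallyAcyclic

variable {A : Type w} [Category.{v} A] [Abelian A]

/-- The complex `Hom(M, T)` is exact. -/
def HomExact (T : ChainComplex A ℤ) (M : A) : Prop :=
  ∀ i j k : ℤ, j + 1 = i → k + 1 = j → ∀ f : M ⟶ T.X j, f ≫ T.d j k = 0 →
    ∃ g : M ⟶ T.X i, g ≫ T.d i j = f

/-- Totally acyclic complexes of injective objects. -/
structure IsTotallyAcyclic (T : ChainComplex A ℤ) : Prop where
  injective : ∀ n, Injective (T.X n)
  exactAt : ∀ n, T.ExactAt n
  homExact : ∀ I : A, Injective I → HomExact T I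

lemma exactAt_iff_exact (T : ChainComplex A ℤ) {i j k : ℤ} (hi : j + 1 = i) (hk : k + 1 = j) :
    T.ExactAt j ↔ (ShortComplex.mk (T.d i j) (T.d j k) (T.d_comp_d _ _ _)).Exact :=
  T.exactAt_iff' i j k (by simp [hi]) (by simp; omega)

lemma exactAt_of_homExact {σ : Type*} {M : σ → A} [∀ s, Projective (M s)]
    (hM : ∀ ⦃X Y : A⦄ (f : X ⟶ Y), (∀ s (m : M s ⟶ X), m ≫ f = 0) → f = 0)
    {T : ChainComplex A ℤ} (hT : ∀ s, HomExact T (M s)) (n : ℤ) : T.ExactAt n := by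
  rw [exactAt_iff_exact T (i := n + 1) (k := n - 1) rfl (by omega),
    ShortComplex.exact_iff_kernel_ι_comp_cokernel_π_zero]
  refine hM _ fun s m => ?_
  obtain ⟨g, hg⟩ := hT s (n + 1) n (n - 1) rfl (by omega) (m ≫ kernel.ι (T.d n (n - 1))) (by simp)
  dsimp
  rw [← Category.assoc, ← hg, Category.assoc, cokernel.condition, comp_zero]

lemma exists_section_of_lift [IsGrothendieckAbelian.{v} A] {σ : Type v} {M : σ → A}
    (hM : ∀ ⦃X Y : A⦄ (f : X ⟶ Y), (∀ s (m : M s ⟶ X), m ≫ f = 0) → f = 0)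
    (hN : ∀ s, IsNoetherianObject (M s)) {P I : A} [Injective I] (p : P ⟶ I)
    (hp : ∀ s (K : Subobject (M s)) (e : Injective.under (cokernel K.arrow) ⟶ I),
      ∃ e', e' ≫ p = e) :
    ∃ t, t ≫ p = 𝟙 I := by
  obtain ⟨Γ, i, _, _, hmax⟩ := exists_maximal_injective hM hN p
  let r : I ⟶ Γ := Injective.factorThru (𝟙 Γ) (i ≫ p)
  have hr : (i ≫ p) ≫ r = 𝟙 Γ := Injective.comp_factorThru _ _
  have hJ' : Injective (kernel r) := by
    refine Retract.injective (Y := I) ⟨kernel.ι r, kernel.lift r (𝟙 I - r ≫ i ≫ p) ?_, ?_⟩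
    · rw [Preadditive.sub_comp, Category.assoc, hr]; simp
    · rw [← cancel_mono (kernel.ι r)]; simp [Preadditive.comp_sub]
  have hzero : 𝟙 (kernel r) = 0 := hM _ fun s m => by
    let K := kernelSubobject m
    have hKm : K.arrow ≫ m = 0 := kernelSubobject_arrow_comp m
    let n : cokernel K.arrow ⟶ kernel r := cokernel.desc _ m hKm
    have : Mono n := mono_of_comp_eq_zero fun W x hx => by
      obtain ⟨W', q, _, y, hy⟩ := surjective_up_to_refinements_of_epi (cokernel.π K.arrow) x
      have hy' : K.Factors y := (kernelSubobject_factors_iff _ _).2 (by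
        rw [← cokernel.π_desc K.arrow m hKm, ← reassoc_of% hy, hx, comp_zero])
      rw [← cancel_epi q, hy, ← K.factorThru_arrow y hy', Category.assoc, cokernel.condition,
        comp_zero, comp_zero]
    obtain ⟨J, a, b, _, ha, hab⟩ := exists_hull n
    have := ha.mono
    have : Mono b := ha.mono_of_mono_comp b (by rw [hab]; infer_instance)
    let c : J ⟶ Injective.under (cokernel K.arrow) := Injective.factorThru (Injective.ι _) a
    have hc : a ≫ c = Injective.ι _ := Injective.comp_factorThru _ _
    have : Mono c := ha.mono_of_mono_comp c (by rw [hc]; infer_instance)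
    let c' : Injective.under (cokernel K.arrow) ⟶ J := Injective.factorThru (𝟙 J) c
    have hc' : c ≫ c' = 𝟙 J := Injective.comp_factorThru _ _
    obtain ⟨e, he⟩ := hp s K (c' ≫ b ≫ kernel.ι r)
    have hmono : Mono (biprod.desc i (c ≫ e) ≫ p) := mono_of_comp_eq_zero fun W x hx => by
      have hdesc : biprod.desc i (c ≫ e) ≫ p =
          biprod.fst ≫ i ≫ p + biprod.snd ≫ b ≫ kernel.ι r := by
        ext <;> simp [he, reassoc_of% hc']
      rw [hdesc] at hx
      have h1 : x ≫ biprod.fst = 0 := by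
        have := hx =≫ r
        simp only [Preadditive.comp_add, Preadditive.add_comp, Category.assoc,
          kernel.condition, comp_zero, add_zero, zero_comp] at this hr
        simpa [hr] using this
      have h2 : x ≫ biprod.snd = 0 := by
        rw [← cancel_mono (b ≫ kernel.ι r)]
        simpa [Preadditive.comp_add, reassoc_of% h1] using hx
      ext <;> simp [h1, h2]
    have hinl := hmax _ (biprod.desc i (c ≫ e)) inferInstance hmono biprod.inl (by simp)
    have hsnd : (biprod.snd : Γ ⊞ J ⟶ J) = 0 := by
      rw [← cancel_epi (biprod.inl : Γ ⟶ Γ ⊞ J)]; simp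
    have hJ : 𝟙 J = 0 := by
      rw [← biprod.inr_snd (X := Γ), hsnd, comp_zero]
    rw [Category.comp_id, ← cokernel.π_desc K.arrow m hKm]
    change _ ≫ n = 0
    rw [← hab, ← Category.comp_id a, hJ]
    simp
  have : Mono r := Preadditive.mono_of_kernel_zero (by
    rw [← Category.id_comp (kernel.ι r), hzero, zero_comp])
  refine ⟨r ≫ i, ?_⟩
  rw [← cancel_mono r, Category.assoc, Category.assoc, ← Category.assoc i, hr]
  simp

lemma homExact_of_injective [IsGrothendieckAbelian.{v} A] {σ : Type v} {M : σ → A}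
    (hM : ∀ ⦃X Y : A⦄ (f : X ⟶ Y), (∀ s (m : M s ⟶ X), m ≫ f = 0) → f = 0)
    (hN : ∀ s, IsNoetherianObject (M s)) {T : ChainComplex A ℤ}
    (hT : ∀ s (K : Subobject (M s)), HomExact T (Injective.under (cokernel K.arrow)))
    (I : A) (hI : Injective I) : HomExact T I := by
  intro i j k hi hk f hf
  obtain ⟨t, ht⟩ := exists_section_of_lift hM hN (pullback.fst f (T.d i j)) (fun s K e => by
    obtain ⟨g, hg⟩ := hT s K i j k hi hk (e ≫ f) (by rw [Category.assoc, hf, comp_zero])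
    exact ⟨pullback.lift e g hg.symm, pullback.lift_fst _ _ _⟩)
  exact ⟨t ≫ pullback.snd _ _, by
    rw [Category.assoc, ← pullback.condition, reassoc_of% ht]⟩

end TotallyAcyclic

section SmallObject

variable {C : Type w} [Category.{v} C] [Abelian C] [IsGrothendieckAbelian.{v} C]

open MorphismProperty in
/-- A small family of monomorphisms in a Grothendieck abelian category permits the small object
argument. -/
lemma hasSmallObjectArgument_of_mono {ι : Type*} [Small.{v} ι] {S T : ι → C}
    (f : ∀ i, S i ⟶ T i) [∀ i, Mono (f i)] : HasSmallObjectArgument.{v} (ofHoms f) := by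
  obtain ⟨κ, hκ', hκ⟩ := HasCardinalLT.exists_regular_cardinal_forall.{v} (fun i => Subobject (S i))
  have : Fact κ.IsRegular := ⟨hκ'⟩
  have : Nonempty κ.ord.ToType := by simpa using hκ'.ne_zero
  have := WellFoundedLT.toOrderBot κ.ord.ToType
  have hle : ofHoms f ≤ monomorphisms C := by
    rintro _ _ _ ⟨i⟩
    exact inferInstanceAs (Mono (f i))
  exact ⟨κ, inferInstance, inferInstance,
    { preservesColimit {A B X Y} i hi g hg := by
        let hg' : (monomorphisms C).TransfiniteCompositionOfShape κ.ord.ToType g :=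
          { toTransfiniteCompositionOfShape := hg.toTransfiniteCompositionOfShape
            map_mem j hj := by
              have := (hg.attachCells j hj).pushouts_coproducts
              simp only [ofHoms_homFamily] at this
              refine (?_ : _ ≤ monomorphisms C) _ this
              simp only [pushouts_le_iff, coproducts_le_iff]
              exact hle }
        have (j j' : κ.ord.ToType) (φ : j ⟶ j') : Mono (hg'.F.map φ) := hg'.mem_map φ
        apply IsGrothendieckAbelian.preservesColimit_coyoneda_obj_of_mono (Y := hg'.F) (κ := κ)
        obtain ⟨i⟩ := hi
        exact hκ i }⟩

open MorphismProperty in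
/-- Factorisation of a morphism as a monomorphism having the left lifting property against the
class `rlp` of a small family of monomorphisms, followed by a morphism in that class. -/
lemma exists_factorization {ι : Type*} [Small.{v} ι] {S T : ι → C}
    (f : ∀ i, S i ⟶ T i) [∀ i, Mono (f i)] {X Y : C} (g : X ⟶ Y) :
    ∃ (Z : C) (a : X ⟶ Z) (b : Z ⟶ Y), a ≫ b = g ∧ Mono a ∧ (ofHoms f).rlp.llp a ∧
      (ofHoms f).rlp b := by
  have := hasSmallObjectArgument_of_mono f
  let F := (functorialFactorizationData (ofHoms f).rlp.llp (ofHoms f).rlp).factorizationData g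
  have hle : ofHoms f ≤ monomorphisms C := by
    rintro _ _ _ ⟨i⟩
    exact inferInstanceAs (Mono (f i))
  refine ⟨F.Z, F.i, F.p, F.fac, ?_, F.hi, F.hp⟩
  have h := antitone_llp (antitone_rlp hle) _ F.hi
  rwa [IsGrothendieckAbelian.llp_rlp_monomorphisms (isSeparator_separator C)] at h

end SmallObject

section Complexes

variable {A : Type w} [Category.{v} A] [Abelian A]

lemma rel_succ (n : ℤ) : (ComplexShape.down ℤ).Rel (n + 1) n := by simp

lemma succ_ne (n : ℤ) : n + 1 ≠ n := by omega

/-- The inclusion of the sphere on `M` in degree `n` into the disk on `M` in degrees `n + 1`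
and `n`. -/
noncomputable def sphereMap (M : A) (n : ℤ) :
    (HomologicalComplex.single A (ComplexShape.down ℤ) n).obj M ⟶
      HomologicalComplex.double (𝟙 M) (rel_succ n) :=
  HomologicalComplex.mkHomFromSingle (HomologicalComplex.doubleXIso₁ _ _ (succ_ne n)).inv
    (fun k _ => by rw [HomologicalComplex.double_d_eq_zero₀ _ _ _ _ (succ_ne n).symm, comp_zero])

instance (M : A) (n : ℤ) : Mono (sphereMap M n) := by
  have : ∀ i, Mono ((sphereMap M n).f i) := fun i => by
    by_cases h : i = n
    · subst h
      rw [sphereMap, HomologicalComplex.mkHomFromSingle_f]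
      infer_instance
    · exact mono_of_comp_eq_zero fun W x _ =>
        (HomologicalComplex.isZero_single_obj_X _ n M i h).eq_of_tgt _ _
  exact HomologicalComplex.mono_of_mono_f _ this

/-- The morphism of disks in degrees `n + 1` and `n` induced by a morphism of objects. -/
noncomputable def diskMap {M N : A} (i : M ⟶ N) (n : ℤ) :
    HomologicalComplex.double (𝟙 M) (rel_succ n) ⟶
      HomologicalComplex.double (𝟙 N) (rel_succ n) :=
  HomologicalComplex.mkHomFromDouble _ (succ_ne n)
    (i ≫ (HomologicalComplex.doubleXIso₀ _ _).inv)
    (i ≫ (HomologicalComplex.doubleXIso₁ _ _ (succ_ne n)).inv)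
    (by simp [HomologicalComplex.double_d _ _ (succ_ne n)])
    (fun k _ => by
      rw [HomologicalComplex.double_d_eq_zero₀ _ _ _ _ (succ_ne n).symm, comp_zero])

instance {M N : A} (i : M ⟶ N) [Mono i] (n : ℤ) : Mono (diskMap i n) := by
  have : ∀ k, Mono ((diskMap i n).f k) := fun k => by
    by_cases h : k = n
    · subst h
      rw [diskMap, HomologicalComplex.mkHomFromDouble_f₁]
      infer_instance
    · by_cases h' : k = n + 1
      · subst h'
        rw [diskMap, HomologicalComplex.mkHomFromDouble_f₀]
        infer_instance
      · exact mono_of_comp_eq_zero fun W x _ =>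
          (HomologicalComplex.isZero_double_X _ _ k h' h).eq_of_tgt _ _
  exact HomologicalComplex.mono_of_mono_f _ this

/-- The right lifting property against `sphereMap M n`, spelled out in degrees. -/
lemma hasLiftingProperty_sphereMap {M : A} {n : ℤ} {E B : ChainComplex A ℤ} (p : E ⟶ B) :
    HasLiftingProperty (sphereMap M n) p ↔
      ∀ (e : M ⟶ E.X n) (b : M ⟶ B.X (n + 1)), (∀ k, k + 1 = n → e ≫ E.d n k = 0) →
        b ≫ B.d (n + 1) n = e ≫ p.f n →
        ∃ x : M ⟶ E.X (n + 1), x ≫ E.d (n + 1) n = e ∧ x ≫ p.f (n + 1) = b := by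
  constructor
  · intro h e b he hb
    let u : (HomologicalComplex.single A (ComplexShape.down ℤ) n).obj M ⟶ E :=
      HomologicalComplex.mkHomFromSingle e (fun k hk => he k hk)
    let w : HomologicalComplex.double (𝟙 M) (rel_succ n) ⟶ B :=
      HomologicalComplex.mkHomFromDouble _ (succ_ne n) b (b ≫ B.d _ _) (by simp) (by simp)
    have sq : CommSq u (sphereMap M n) p w := ⟨by
      ext
      simp [u, w, sphereMap, hb]⟩
    obtain ⟨l, hl, hr⟩ : ∃ l, sphereMap M n ≫ l = u ∧ l ≫ p = w :=
      ⟨sq.lift, sq.fac_left, sq.fac_right⟩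
    refine ⟨(HomologicalComplex.doubleXIso₀ _ _).inv ≫ l.f (n + 1), ?_, ?_⟩
    · have h1 := congrArg (fun φ => HomologicalComplex.Hom.f φ n) hl
      simp only [HomologicalComplex.comp_f, sphereMap, u,
        HomologicalComplex.mkHomFromSingle_f, Category.assoc, Iso.cancel_iso_hom_left] at h1
      simp [HomologicalComplex.double_d _ _ (succ_ne n), h1]
    · have h1 := congrArg (fun φ => HomologicalComplex.Hom.f φ (n + 1)) hr
      simp only [HomologicalComplex.comp_f, w, HomologicalComplex.mkHomFromDouble_f₀] at h1
      simp [h1]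
  · intro h
    refine ⟨fun {f g} sq => ?_⟩
    obtain ⟨x, hx, hx'⟩ := h
      ((HomologicalComplex.singleObjXSelf (ComplexShape.down ℤ) n M).inv ≫ f.f n)
      ((HomologicalComplex.doubleXIso₀ _ _).inv ≫ g.f (n + 1)) (fun k _ => by simp) (by
        have h1 := congrArg (fun φ => HomologicalComplex.Hom.f φ n) sq.w
        simp only [HomologicalComplex.comp_f, sphereMap,
          HomologicalComplex.mkHomFromSingle_f, Category.assoc] at h1
        simp [HomologicalComplex.double_d _ _ (succ_ne n), h1])
    refine ⟨⟨⟨HomologicalComplex.mkHomFromDouble _ (succ_ne n) x (x ≫ E.d _ _) (by simp)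
      (by simp), ?_, ?_⟩⟩⟩
    · ext
      simp [sphereMap, hx]
    · ext
      · simp [hx']
      · simp [hx]
        have h1 := congrArg (fun φ => HomologicalComplex.Hom.f φ n) sq.w
        simp only [HomologicalComplex.comp_f, sphereMap,
          HomologicalComplex.mkHomFromSingle_f, Category.assoc] at h1
        simp [h1]

/-- The right lifting property against `diskMap i n`, spelled out in degrees. -/
lemma hasLiftingProperty_diskMap {M N : A} (i : M ⟶ N) (n : ℤ) {E B : ChainComplex A ℤ}
    (p : E ⟶ B) :
    HasLiftingProperty (diskMap i n) p ↔ HasLiftingProperty i (p.f (n + 1)) := by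
  constructor
  · intro h
    refine ⟨fun {f g} sq => ?_⟩
    let u : HomologicalComplex.double (𝟙 M) (rel_succ n) ⟶ E :=
      HomologicalComplex.mkHomFromDouble _ (succ_ne n) f (f ≫ E.d _ _) (by simp) (by simp)
    let w : HomologicalComplex.double (𝟙 N) (rel_succ n) ⟶ B :=
      HomologicalComplex.mkHomFromDouble _ (succ_ne n) g (g ≫ B.d _ _) (by simp) (by simp)
    have sq' : CommSq u (diskMap i n) p w := ⟨by
      ext
      · simp [u, w, diskMap, sq.w]
      · have := sq.w =≫ B.d (n + 1) n
        simp only [Category.assoc, HomologicalComplex.Hom.comm] at this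
        simp [u, w, diskMap, this]⟩
    obtain ⟨l, hl, hr⟩ : ∃ l, diskMap i n ≫ l = u ∧ l ≫ p = w :=
      ⟨sq'.lift, sq'.fac_left, sq'.fac_right⟩
    refine ⟨⟨⟨(HomologicalComplex.doubleXIso₀ _ _).inv ≫ l.f (n + 1), ?_, ?_⟩⟩⟩
    · have h1 := congrArg (fun φ => HomologicalComplex.Hom.f φ (n + 1)) hl
      simpa [u, diskMap] using h1
    · have h1 := congrArg (fun φ => HomologicalComplex.Hom.f φ (n + 1)) hr
      simp only [HomologicalComplex.comp_f, w, HomologicalComplex.mkHomFromDouble_f₀] at h1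
      simp [h1]
  · intro h
    refine ⟨fun {f g} sq => ?_⟩
    have sq' : CommSq ((HomologicalComplex.doubleXIso₀ (𝟙 M) (rel_succ n)).inv ≫ f.f (n + 1)) i
        (p.f (n + 1)) ((HomologicalComplex.doubleXIso₀ (𝟙 N) (rel_succ n)).inv ≫ g.f (n + 1)) :=
      ⟨by
        have h1 := congrArg (fun φ => HomologicalComplex.Hom.f φ (n + 1)) sq.w
        simp only [HomologicalComplex.comp_f, diskMap,
          HomologicalComplex.mkHomFromDouble_f₀, Category.assoc] at h1
        simp [h1]⟩
    have hl : i ≫ sq'.lift = _ := sq'.fac_left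
    have hr : sq'.lift ≫ p.f (n + 1) = _ := sq'.fac_right
    refine ⟨⟨⟨HomologicalComplex.mkHomFromDouble _ (succ_ne n) sq'.lift (sq'.lift ≫ E.d _ _)
      (by simp) (by simp), ?_, ?_⟩⟩⟩
    · ext
      · simp [diskMap, hl]
      · simp [diskMap, reassoc_of% hl, HomologicalComplex.double_d _ _ (succ_ne n)]
    · ext
      · simp [hr]
      · have := hr =≫ B.d (n + 1) n
        simp only [Category.assoc, HomologicalComplex.Hom.comm] at this
        simp [this, HomologicalComplex.double_d _ _ (succ_ne n)]


/-- The path object of a chain complex: a morphism `K ⟶ pathComplex T` amounts to a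
null-homotopic morphism `K ⟶ T` together with a null-homotopy. -/
noncomputable def pathComplex (T : ChainComplex A ℤ) : ChainComplex A ℤ where
  X i := T.X (i + 1) ⊞ T.X i
  d i j := if h : j + 1 = i then biprod.snd ≫ (T.XIsoOfEq h.symm).hom ≫ biprod.inl else 0
  shape i j h := dif_neg h
  d_comp_d' i j k h h' := by
    obtain rfl : j + 1 = i := h
    obtain rfl : k + 1 = j := h'
    simp

namespace pathComplex

/-- The component of degree `n + 1` of the path object in degree `n`. -/
noncomputable def fst (T : ChainComplex A ℤ) (n : ℤ) : (pathComplex T).X n ⟶ T.X (n + 1) :=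
  (biprod.fst : T.X (n + 1) ⊞ T.X n ⟶ T.X (n + 1))

/-- The component of degree `n` of the path object in degree `n`. -/
noncomputable def snd (T : ChainComplex A ℤ) (n : ℤ) : (pathComplex T).X n ⟶ T.X n :=
  (biprod.snd : T.X (n + 1) ⊞ T.X n ⟶ T.X n)

/-- Morphisms into the path object in a given degree. -/
noncomputable def lift {T : ChainComplex A ℤ} {n : ℤ} {M : A} (a : M ⟶ T.X (n + 1))
    (b : M ⟶ T.X n) : M ⟶ (pathComplex T).X n :=
  biprod.lift a b

variable {T : ChainComplex A ℤ} {n : ℤ} {M : A}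

@[simp]
lemma lift_fst (a : M ⟶ T.X (n + 1)) (b : M ⟶ T.X n) : lift a b ≫ fst T n = a :=
  biprod.lift_fst a b

@[simp]
lemma lift_snd (a : M ⟶ T.X (n + 1)) (b : M ⟶ T.X n) : lift a b ≫ snd T n = b :=
  biprod.lift_snd a b

lemma hom_ext {f g : M ⟶ (pathComplex T).X n} (h₁ : f ≫ fst T n = g ≫ fst T n)
    (h₂ : f ≫ snd T n = g ≫ snd T n) : f = g :=
  biprod.hom_ext (X := T.X (n + 1)) (Y := T.X n) f g h₁ h₂

lemma d_eq (T : ChainComplex A ℤ) (n : ℤ) :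
    (pathComplex T).d (n + 1) n =
      (biprod.snd ≫ biprod.inl : T.X (n + 1 + 1) ⊞ T.X (n + 1) ⟶ T.X (n + 1) ⊞ T.X n) := by
  simp [pathComplex]

@[simp]
lemma d_fst (T : ChainComplex A ℤ) (n : ℤ) :
    (pathComplex T).d (n + 1) n ≫ fst T n = snd T (n + 1) := by
  rw [d_eq]
  exact (Category.assoc _ _ _).trans
    ((congrArg (biprod.snd ≫ ·) biprod.inl_fst).trans (Category.comp_id _))

@[simp]
lemma d_snd (T : ChainComplex A ℤ) (n : ℤ) : (pathComplex T).d (n + 1) n ≫ snd T n = 0 := by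
  rw [d_eq]
  exact (Category.assoc _ _ _).trans ((congrArg (biprod.snd ≫ ·) biprod.inl_snd).trans comp_zero)

@[simp]
lemma lift_fst_assoc (a : M ⟶ T.X (n + 1)) (b : M ⟶ T.X n) {Z : A} (h : T.X (n + 1) ⟶ Z) :
    lift a b ≫ fst T n ≫ h = a ≫ h := by
  rw [← Category.assoc, lift_fst]

@[simp]
lemma d_fst_assoc (T : ChainComplex A ℤ) (n : ℤ) {Z : A} (h : T.X (n + 1) ⟶ Z) :
    (pathComplex T).d (n + 1) n ≫ fst T n ≫ h = snd T (n + 1) ≫ h := by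
  rw [← Category.assoc, d_fst]

/-- The projection from the path object. -/
noncomputable def π (T : ChainComplex A ℤ) : pathComplex T ⟶ T where
  f i := fst T i ≫ T.d (i + 1) i + snd T i
  comm' i j h := by
    obtain rfl : j + 1 = i := h
    simp

@[simp]
lemma π_f (T : ChainComplex A ℤ) (n : ℤ) : (π T).f n = fst T n ≫ T.d (n + 1) n + snd T n := rfl

lemma exists_homotopy_of_factors {T T' : ChainComplex A ℤ} (φ : T ⟶ T')
    (l : T ⟶ pathComplex T') (hl : l ≫ π T' = φ) (j k : ℤ) (h : k + 1 = j) :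
    ∃ (h₀ : T.X j ⟶ T'.X (j + 1)) (h₁ : T.X k ⟶ T'.X j),
      φ.f j = h₀ ≫ T'.d (j + 1) j + T.d j k ≫ h₁ := by
  subst h
  refine ⟨l.f (k + 1) ≫ fst _ _, l.f k ≫ fst _ _, ?_⟩
  simp [← hl, ← HomologicalComplex.Hom.comm_assoc]

lemma hasLiftingProperty_sphereMap (hM : HomExact T M) (n : ℤ) :
    HasLiftingProperty (sphereMap M n) (π T) := by
  rw [GorensteinEnvelope.hasLiftingProperty_sphereMap]
  intro e b he hb
  obtain ⟨n, rfl⟩ : ∃ m, n = m + 1 := ⟨n - 1, by omega⟩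
  have he' : e ≫ snd T _ = 0 := by
    simpa using he n rfl =≫ fst T n
  simp only [π_f, Preadditive.comp_add, he', add_zero] at hb
  obtain ⟨c, hc⟩ := hM (n + 1 + 1 + 1) (n + 1 + 1) (n + 1) rfl rfl (b - e ≫ fst T _) (by
    simp [Preadditive.sub_comp, hb])
  exact ⟨lift c (e ≫ fst T _), hom_ext (by simp) (by simp [he']), by simp [hc]⟩

lemma hasLiftingProperty_π_f (T : ChainComplex A ℤ) (n : ℤ)
    [Injective (T.X (n + 1))] {K L : A} (i : K ⟶ L) [Mono i] :
    HasLiftingProperty i ((π T).f n) := by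
  refine ⟨fun {f g} sq => ?_⟩
  have ha := Injective.comp_factorThru (f ≫ fst T n) i
  set a := Injective.factorThru (f ≫ fst T n) i
  have hw : i ≫ g = f ≫ fst T n ≫ T.d (n + 1) n + f ≫ snd T n := by
    simpa using sq.w.symm
  exact ⟨⟨⟨lift a (g - a ≫ T.d (n + 1) n), hom_ext (by simpa using ha)
    (by simp [Preadditive.comp_sub, hw, reassoc_of% ha]), by simp⟩⟩⟩

end pathComplex

end Complexes

section Construction

open ZeroObject

variable {A : Type w} [Category.{v} A] [Abelian A] [IsGrothendieckAbelian.{v} A]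

/-- A relative form of the construction of totally acyclic complexes, in which exactness of
`Hom` complexes is only tested on a small family `N` of objects. -/
theorem exists_homExact_complex {τ : Type*} [Small.{v} τ] (N : τ → A) (X : A) :
    ∃ (T : ChainComplex A ℤ) (g : X ⟶ T.X 0), Mono g ∧ g ≫ T.d 0 (-1) = 0 ∧
      (∀ n, Injective (T.X n)) ∧ (∀ t, HomExact T (N t)) ∧
      ∀ T' : ChainComplex A ℤ, (∀ n, Injective (T'.X n)) → (∀ t, HomExact T' (N t)) →
        (∀ f : X ⟶ T'.X 0, f ≫ T'.d 0 (-1) = 0 → ∃ φ : T ⟶ T', g ≫ φ.f 0 = f) ∧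
        (∀ φ : T ⟶ T', g ≫ φ.f 0 = 0 → ∃ (h₀ : T.X 0 ⟶ T'.X 1) (h₁ : T.X (-1) ⟶ T'.X 0),
          φ.f 0 = h₀ ≫ T'.d 1 0 + T.d 0 (-1) ≫ h₁) := by
  let F : (τ × ℤ) ⊕ (Subobject (separator A) × ℤ) → Arrow (ChainComplex A ℤ) :=
    Sum.elim (fun x => Arrow.mk (sphereMap (N x.1) x.2)) (fun x => Arrow.mk (diskMap x.1.arrow x.2))
  have hF : ∀ i, Mono (F i).hom := by
    rintro (x | x)
    · exact inferInstanceAs (Mono (sphereMap _ _))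
    · exact inferInstanceAs (Mono (diskMap _ _))
  have hrlp : ∀ {E B : ChainComplex A ℤ} (p : E ⟶ B),
      (MorphismProperty.ofHoms (fun i => (F i).hom)).rlp p ↔
        (∀ t n, HasLiftingProperty (sphereMap (N t) n) p) ∧
        ∀ n {K L : A} (i : K ⟶ L), Mono i → HasLiftingProperty i (p.f n) := by
    intro E B p
    constructor
    · intro h
      refine ⟨fun t n => h _ ⟨Sum.inl (t, n)⟩, fun n K L i hi => ?_⟩
      obtain ⟨n, rfl⟩ : ∃ m, n = m + 1 := ⟨n - 1, by omega⟩
      have h' : (IsGrothendieckAbelian.generatingMonomorphisms (separator A)).rlp (p.f (n + 1)) := by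
        rintro _ _ _ ⟨S⟩
        exact (hasLiftingProperty_diskMap _ n p).1 (h _ ⟨Sum.inr (S, n)⟩)
      rw [IsGrothendieckAbelian.generatingMonomorphisms_rlp (isSeparator_separator A)] at h'
      exact h' i hi
    · rintro ⟨h₁, h₂⟩ _ _ _ ⟨x | x⟩
      · exact h₁ _ _
      · exact (hasLiftingProperty_diskMap _ _ p).2 (h₂ _ _ inferInstance)
  have hzero : ∀ T' : ChainComplex A ℤ,
      (MorphismProperty.ofHoms (fun i => (F i).hom)).rlp (0 : T' ⟶ 0) ↔
        (∀ n, Injective (T'.X n)) ∧ (∀ t, HomExact T' (N t)) := by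
    intro T'
    have h0 : ∀ n, IsZero ((0 : ChainComplex A ℤ).X n) := fun n =>
      (HomologicalComplex.eval A (ComplexShape.down ℤ) n).map_isZero (isZero_zero _)
    rw [hrlp, and_comm]
    refine and_congr (forall_congr' fun n => ?_) (forall_congr' fun t => ?_)
    · constructor
      · intro h
        refine ⟨fun {K L} f i hi => ?_⟩
        have := h i hi
        have sq : CommSq f i ((0 : T' ⟶ 0).f n) 0 := ⟨(h0 n).eq_of_tgt _ _⟩
        exact ⟨sq.lift, sq.fac_left⟩
      · intro h K L i hi
        exact ⟨fun {f g} sq => ⟨⟨⟨Injective.factorThru f i, Injective.comp_factorThru f i,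
          (h0 n).eq_of_tgt _ _⟩⟩⟩⟩
    · constructor
      · rintro h i j k rfl rfl f hf
        obtain ⟨x, hx, -⟩ := (hasLiftingProperty_sphereMap _).1 (h (k + 1)) f 0 (fun l hl => by
          obtain rfl : l = k := by omega
          exact hf) ((h0 _).eq_of_tgt _ _)
        exact ⟨x, hx⟩
      · intro h n
        refine (hasLiftingProperty_sphereMap _).2 fun e b he hb => ?_
        obtain ⟨x, hx⟩ := h (n + 1) n (n - 1) rfl (by omega) e (he _ (by omega))
        exact ⟨x, hx, (h0 _).eq_of_tgt _ _⟩
  obtain ⟨T, j, q, -, hj, hllp, hq⟩ := exists_factorization (fun i => (F i).hom)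
    (0 : (HomologicalComplex.single A (ComplexShape.down ℤ) 0).obj X ⟶ 0)
  obtain rfl : q = 0 := (isZero_zero _).eq_of_tgt _ _
  obtain ⟨hT, hT'⟩ := (hzero T).1 hq
  refine ⟨T, (HomologicalComplex.singleObjXSelf _ 0 X).inv ≫ j.f 0, ?_, by simp, hT, hT',
    fun T' h₁ h₂ => ⟨fun f hf => ?_, fun φ hφ => ?_⟩⟩
  · have : Mono (j.f 0) :=
      inferInstanceAs (Mono ((HomologicalComplex.eval A (ComplexShape.down ℤ) 0).map j))
    infer_instance
  · have := hllp _ ((hzero T').2 ⟨h₁, h₂⟩)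
    have sq : CommSq (HomologicalComplex.mkHomFromSingle f (fun k hk => by
        obtain rfl : k = -1 := by simp at hk; omega
        exact hf)) j (0 : T' ⟶ 0) 0 := ⟨(isZero_zero _).eq_of_tgt _ _⟩
    obtain ⟨l, hl⟩ : ∃ l, j ≫ l = _ := ⟨sq.lift, sq.fac_left⟩
    refine ⟨l, ?_⟩
    rw [Category.assoc, ← HomologicalComplex.comp_f, hl]
    simp
  · have := hllp (pathComplex.π T') ((hrlp _).2
      ⟨fun t n => pathComplex.hasLiftingProperty_sphereMap (h₂ t) n,
        fun n K L i hi => pathComplex.hasLiftingProperty_π_f T' n i⟩)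
    have sq : CommSq 0 j (pathComplex.π T') φ := ⟨by
      ext
      rw [← cancel_epi (HomologicalComplex.singleObjXSelf (ComplexShape.down ℤ) 0 X).inv]
      simpa using hφ.symm⟩
    exact pathComplex.exists_homotopy_of_factors φ sq.lift sq.fac_right 0 (-1) rfl

end Construction

/-- Two-sided recursion along `ℤ`, with a relation between consecutive terms. -/
lemma exists_int_family {α : ℤ → Type*} (R : ∀ i j : ℤ, j + 1 = i → α i → α j → Prop)
    (up : ∀ i j h (a : α j), ∃ b, R i j h b a) (down : ∀ i j h (b : α i), ∃ a, R i j h b a)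
    (a₀ : α 0) : ∃ f : ∀ n, α n, f 0 = a₀ ∧ ∀ i j h, R i j h (f i) (f j) := by
  choose up hup using up
  choose down hdown using down
  let f : ∀ n, α n := fun n => Int.inductionOn' (motive := α) n 0 a₀
    (fun k _ a => up (k + 1) k rfl a) (fun k _ b => down k (k - 1) (by omega) b)
  refine ⟨f, Int.inductionOn'_self, fun i j h => ?_⟩
  rcases le_or_gt 0 j with hj | hj
  · subst h
    have : f (j + 1) = up (j + 1) j rfl (f j) := Int.inductionOn'_add_one hj
    rw [this]
    exact hup _ _ _ _
  · obtain rfl : j = i - 1 := by omega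
    have : f (i - 1) = down i (i - 1) (by omega) (f i) :=
      Int.inductionOn'_sub_one (by omega)
    rw [this]
    exact hdown _ _ _ _

section Lifting

variable {A : Type w} [Category.{v} A] [Abelian A]

lemma exists_hom_of_isTotallyAcyclic {T T' : ChainComplex A ℤ} (hT : IsTotallyAcyclic T)
    (hT' : IsTotallyAcyclic T') (f : T.X 0 ⟶ T'.X 0) (hf : T.d 1 0 ≫ f ≫ T'.d 0 (-1) = 0) :
    ∃ φ : T ⟶ T', φ.f 0 = f := by
  let α : ℤ → Type v := fun n => { g : T.X n ⟶ T'.X n //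
    ∀ i k : ℤ, n + 1 = i → k + 1 = n → T.d i n ≫ g ≫ T'.d n k = 0 }
  obtain ⟨φ, hφ, hcomm⟩ := exists_int_family (α := α)
    (fun i j _ b a => b.1 ≫ T'.d i j = T.d i j ≫ a.1)
    (fun i j h a => by
      obtain ⟨b, hb⟩ := hT'.homExact _ (hT.injective i) i j (j - 1) h (by omega)
        (T.d i j ≫ a.1) (by rw [Category.assoc]; exact a.2 _ _ h (by omega))
      refine ⟨⟨b, fun i' k hi' hk => ?_⟩, hb⟩
      obtain rfl : k = j := by omega
      rw [hb, T.d_comp_d_assoc, zero_comp])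
    (fun i j h b => by
      have hex := (exactAt_iff_exact T (i := i + 1) rfl h).1 (hT.exactAt i)
      have := hT'.injective j
      have h0 : T.d (i + 1) i ≫ b.1 ≫ T'.d i j = 0 := b.2 _ _ rfl h
      refine ⟨⟨hex.descToInjective _ h0, fun i' k hi' hk => ?_⟩,
        (hex.comp_descToInjective _ h0).symm⟩
      obtain rfl : i' = i := by omega
      have := hex.comp_descToInjective _ h0
      dsimp at this
      rw [reassoc_of% this, T'.d_comp_d, comp_zero])
    ⟨f, fun i k hi hk => by
      obtain rfl : i = 1 := by omega
      obtain rfl : k = -1 := by omega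
      exact hf⟩
  exact ⟨{ f := fun n => (φ n).1, comm' := fun i j h => hcomm i j h },
    congrArg Subtype.val hφ⟩

lemma kernel_exists_hom {X : A} {T T' : ChainComplex A ℤ} (ψ : X ⟶ kernel (T.d 0 (-1)))
    (hψ : ∀ f : X ⟶ T'.X 0, f ≫ T'.d 0 (-1) = 0 →
      ∃ φ : T ⟶ T', (ψ ≫ kernel.ι _) ≫ φ.f 0 = f)
    (f : X ⟶ kernel (T'.d 0 (-1))) : ∃ h, ψ ≫ h = f := by
  obtain ⟨φ, hφ⟩ := hψ (f ≫ kernel.ι _) (by simp)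
  refine ⟨kernel.map _ _ (φ.f 0) (φ.f (-1)) (φ.comm _ _).symm, ?_⟩
  rw [← cancel_mono (kernel.ι _), ← hφ]
  simp

lemma kernel_exists_factor {X : A} {T T' : ChainComplex A ℤ} (hT : IsTotallyAcyclic T)
    (hT' : IsTotallyAcyclic T') (ψ : X ⟶ kernel (T.d 0 (-1)))
    (hψ : ∀ φ : T ⟶ T', (ψ ≫ kernel.ι _) ≫ φ.f 0 = 0 →
      ∃ (h₀ : T.X 0 ⟶ T'.X 1) (h₁ : T.X (-1) ⟶ T'.X 0),
        φ.f 0 = h₀ ≫ T'.d 1 0 + T.d 0 (-1) ≫ h₁)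
    (δ : kernel (T.d 0 (-1)) ⟶ kernel (T'.d 0 (-1))) (hδ : ψ ≫ δ = 0) :
    ∃ (I : A) (p : kernel (T.d 0 (-1)) ⟶ I) (q : I ⟶ kernel (T'.d 0 (-1))),
      Injective I ∧ p ≫ q = δ := by
  have := hT'.injective 0
  let f : T.X 0 ⟶ T'.X 0 := Injective.factorThru (δ ≫ kernel.ι _) (kernel.ι _)
  have hf : kernel.ι _ ≫ f = δ ≫ kernel.ι _ := Injective.comp_factorThru _ _
  obtain ⟨φ, hφ⟩ := exists_hom_of_isTotallyAcyclic hT hT' f (by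
    rw [← kernel.lift_ι (T.d 0 (-1)) (T.d 1 0) (T.d_comp_d _ _ _), Category.assoc,
      reassoc_of% hf, kernel.condition, comp_zero, comp_zero])
  obtain ⟨h₀, h₁, hh⟩ := hψ φ (by rw [hφ, Category.assoc, hf, reassoc_of% hδ, zero_comp])
  refine ⟨T'.X 1, kernel.ι _ ≫ h₀, kernel.lift _ (T'.d 1 0) (T'.d_comp_d _ _ _),
    hT'.injective 1, ?_⟩
  rw [← cancel_mono (kernel.ι _), ← hf, ← hφ, hh]
  simp [Preadditive.comp_add]

lemma IsTotallyAcyclic.of_retract {T T' : ChainComplex A ℤ} (hT : IsTotallyAcyclic T)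
    (r : Retract T' T) : IsTotallyAcyclic T' where
  injective n := by
    have := hT.injective n
    exact Retract.injective (Y := T.X n) (r.map (HomologicalComplex.eval A _ n))
  exactAt n := by
    have h := hT.exactAt n
    rw [HomologicalComplex.exactAt_iff_isZero_homology] at h ⊢
    let r' := r.map (HomologicalComplex.homologyFunctor A _ n)
    exact (IsZero.iff_id_eq_zero _).2 (r'.retract.symm.trans
      ((congrArg (· ≫ r'.r) (h.eq_of_tgt r'.i 0)).trans zero_comp))
  homExact I hI i j k hi hk f hf := by
    obtain ⟨g, hg⟩ := hT.homExact I hI i j k hi hk (f ≫ r.i.f j) (by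
      rw [Category.assoc, r.i.comm, reassoc_of% hf, zero_comp])
    refine ⟨g ≫ r.r.f i, ?_⟩
    rw [Category.assoc, r.r.comm, reassoc_of% hg, ← HomologicalComplex.comp_f, r.retract,
      HomologicalComplex.id_f, Category.comp_id]

lemma exists_complement {T : ChainComplex A ℤ} (hT : IsTotallyAcyclic T) {I : A} [Injective I]
    (i : I ⟶ kernel (T.d 0 (-1))) (r : kernel (T.d 0 (-1)) ⟶ I) (hir : i ≫ r = 𝟙 I) :
    ∃ (T' : ChainComplex A ℤ) (a : kernel (T'.d 0 (-1)) ⟶ kernel (T.d 0 (-1)))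
      (b : kernel (T.d 0 (-1)) ⟶ kernel (T'.d 0 (-1))), IsTotallyAcyclic T' ∧
      a ≫ b = 𝟙 _ ∧ b ≫ a = 𝟙 _ - r ≫ i := by
  let ρ : T.X 0 ⟶ I := Injective.factorThru r (kernel.ι _)
  have hρ : kernel.ι _ ≫ ρ = r := Injective.comp_factorThru _ _
  obtain ⟨s, hs⟩ := hT.homExact I inferInstance 1 0 (-1) rfl rfl (i ≫ kernel.ι _) (by simp)
  have hsρ : s ≫ T.d 1 0 ≫ ρ = 𝟙 I := by rw [reassoc_of% hs, hρ, hir]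
  let h : ∀ i j, (ComplexShape.down ℤ).Rel j i → (T.X i ⟶ T.X j) := fun i j hij =>
    if h0 : i = 0 then (T.XIsoOfEq h0).hom ≫ ρ ≫ s ≫
      (T.XIsoOfEq (show 1 = j by rw [← show i + 1 = j from hij, h0]; rfl)).hom else 0
  let e : T ⟶ T := Homotopy.nullHomotopicMap' h
  have he0 : e.f 0 = ρ ≫ s ≫ T.d 1 0 := by
    dsimp [e]
    rw [Homotopy.nullHomotopicMap'_f (k₂ := 1) (k₁ := 0) (k₀ := -1) (by simp) (by simp)]
    simp [h]
  have hee : e ≫ e = e := by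
    refine (Homotopy.comp_nullHomotopicMap' _ _).trans ?_
    congr 1
    funext i j hij
    by_cases h0 : i = 0
    · subst h0
      simp [h, he0, reassoc_of% hsρ]
    · simp [h, h0]
  let a : kernel e ⟶ T := kernel.ι e
  let b : T ⟶ kernel e := kernel.lift e (𝟙 T - e) (by simp [Preadditive.sub_comp, hee])
  have hba : b ≫ a = 𝟙 T - e := kernel.lift_ι _ _ _
  have hab : a ≫ b = 𝟙 _ := by
    rw [← cancel_mono a, Category.assoc, hba]
    simp [a, Preadditive.comp_sub]
  refine ⟨kernel e, kernel.map _ _ (a.f 0) (a.f (-1)) (a.comm _ _).symm,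
    kernel.map _ _ (b.f 0) (b.f (-1)) (b.comm _ _).symm, hT.of_retract ⟨a, b, hab⟩, ?_, ?_⟩
  · rw [← cancel_mono (kernel.ι _)]
    have := HomologicalComplex.congr_hom hab 0
    simp at this
    simp [this]
  · rw [← cancel_mono (kernel.ι _)]
    have := HomologicalComplex.congr_hom hba 0
    simp at this
    simp [this, he0, Preadditive.comp_sub, Preadditive.sub_comp, reassoc_of% hρ, hs]

end Lifting

section Minimality

variable {A : Type w} [Category.{v} A] [Abelian A]

/-- No nonzero injective object embeds in `G` with its image meeting that of `ψ` trivially. -/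
def IsReduced {X G : A} (ψ : X ⟶ G) : Prop :=
  ∀ (J : A) (j : J ⟶ G), Injective J → Mono (j ≫ cokernel.π ψ) → IsZero J

lemma injective_kernel_of_section {X Y : A} [Injective X] {i : Y ⟶ X} {r : X ⟶ Y}
    (h : i ≫ r = 𝟙 Y) : Injective (kernel r) := by
  refine Retract.injective (Y := X) ⟨kernel.ι r, kernel.lift r (𝟙 X - r ≫ i) ?_, ?_⟩
  · simp [Preadditive.sub_comp, h]
  · rw [← cancel_mono (kernel.ι r)]; simp [Preadditive.comp_sub]

lemma isZero_of_isIso_inl {X Y : A} (h : IsIso (biprod.inl : X ⟶ X ⊞ Y)) : IsZero Y := by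
  have hsnd : (biprod.snd : X ⊞ Y ⟶ Y) = 0 := by
    rw [← cancel_epi (biprod.inl : X ⟶ X ⊞ Y)]; simp
  rw [IsZero.iff_id_eq_zero, ← biprod.inr_snd (X := X), hsnd, comp_zero]

variable [IsGrothendieckAbelian.{v} A]

lemma isIso_of_factors_injective {X G I : A} {ψ : X ⟶ G} [Mono ψ] [Injective I]
    (hψ : IsReduced ψ) (φ : G ⟶ G) (hφ : ψ ≫ φ = ψ) (p : G ⟶ I) (q : I ⟶ G)
    (hpq : φ = 𝟙 G + p ≫ q) : IsIso φ := by
  have hlift : ∀ {W : A} (y : W ⟶ G), y ≫ cokernel.π ψ = 0 → y ≫ φ = y := fun y hy => by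
    rw [← Abelian.monoLift_comp ψ y hy, Category.assoc, hφ]
  have hmono : Mono φ := by
    have hk : kernel.ι φ + kernel.ι φ ≫ p ≫ q = 0 := by
      have h2 : kernel.ι φ ≫ φ = kernel.ι φ + kernel.ι φ ≫ p ≫ q :=
        (congrArg (kernel.ι φ ≫ ·) hpq).trans (by simp)
      rw [← h2]
      exact kernel.condition φ
    have hn : Mono (kernel.ι φ ≫ p) := mono_of_comp_eq_zero fun W x hx => by
      rw [← cancel_mono (kernel.ι φ)]
      have := x ≫= hk
      simpa [Preadditive.comp_add, reassoc_of% hx] using this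
    obtain ⟨J, a, b, hJ, ha, hab⟩ := exists_hull (kernel.ι φ ≫ p)
    have hkπ : Mono (kernel.ι φ ≫ cokernel.π ψ) := mono_of_comp_eq_zero fun W x hx => by
      have := hlift (x ≫ kernel.ι φ) (by simpa using hx)
      rw [Category.assoc, kernel.condition, comp_zero] at this
      rw [← cancel_mono (kernel.ι φ), ← this, zero_comp]
    have hb : Mono ((b ≫ q) ≫ cokernel.π ψ) := ha.mono_of_mono_comp _ (by
      have : a ≫ (b ≫ q) ≫ cokernel.π ψ = -(kernel.ι φ ≫ cokernel.π ψ) := by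
        rw [← Preadditive.neg_comp, ← eq_neg_of_add_eq_zero_right hk]
        simp only [Category.assoc, reassoc_of% hab]
      rw [this]
      infer_instance)
    have h0 := hψ J (b ≫ q) hJ hb
    have hn0 : kernel.ι φ ≫ p = 0 := by rw [← hab, h0.eq_of_tgt a 0, zero_comp]
    refine Preadditive.mono_of_kernel_zero ?_
    simpa [reassoc_of% hn0] using hk
  let θ : I ⟶ I := 𝟙 I + q ≫ p
  have hqφ : q ≫ φ = θ ≫ q := by simp [hpq, θ, Preadditive.comp_add, Preadditive.add_comp]
  have hθ : Mono θ := mono_of_comp_eq_zero fun W x hx => by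
    have hxq : x ≫ q = 0 := by
      rw [← cancel_mono φ, Category.assoc, hqφ, reassoc_of% hx, zero_comp, zero_comp]
    simpa [θ, Preadditive.comp_add, reassoc_of% hxq] using hx
  let ρ : I ⟶ I := Injective.factorThru (𝟙 I) θ
  have hθρ : θ ≫ ρ = 𝟙 I := Injective.comp_factorThru _ _
  have hC : Mono ((kernel.ι ρ ≫ q) ≫ cokernel.π ψ) := mono_of_comp_eq_zero fun W x hx => by
    let y := x ≫ kernel.ι ρ ≫ q
    have hy : y ≫ φ = y := hlift y (by simpa [y] using hx)
    have hypq : y ≫ p ≫ q = 0 := by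
      simpa [hpq, Preadditive.comp_add] using hy
    have h1 : x ≫ kernel.ι ρ = (x ≫ kernel.ι ρ - y ≫ p) ≫ θ := by
      simp [θ, Preadditive.comp_add, Preadditive.sub_comp, reassoc_of% hypq]
      simp [y]
    have h2 : x ≫ kernel.ι ρ - y ≫ p = 0 := by
      have := h1 =≫ ρ
      simpa [-Preadditive.sub_comp, hθρ] using this.symm
    rw [← cancel_mono (kernel.ι ρ), h1, h2, zero_comp, zero_comp]
  have h0 := hψ _ _ (injective_kernel_of_section hθρ) hC
  have hρ : Mono ρ := Preadditive.mono_of_kernel_zero (h0.eq_of_src _ _)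
  have hρθ : ρ ≫ θ = 𝟙 I := by
    rw [← cancel_mono ρ, Category.assoc, hθρ, Category.comp_id, Category.id_comp]
  have hinv : (𝟙 G - p ≫ ρ ≫ q) ≫ φ = 𝟙 G := by
    rw [Preadditive.sub_comp, Category.assoc, Category.assoc, hqφ, reassoc_of% hρθ, hpq]
    simp
  exact ⟨𝟙 G - p ≫ ρ ≫ q, by rw [← cancel_mono φ, Category.assoc, hinv]; simp, hinv⟩

/-- A monic preenvelope such that the endomorphisms killed by it factor through injectives can be
trimmed to an envelope. -/
lemma exists_isEnvelope {σ : Type v} {M : σ → A}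
    (hM : ∀ ⦃X Y : A⦄ (f : X ⟶ Y), (∀ s (m : M s ⟶ X), m ≫ f = 0) → f = 0)
    (hN : ∀ s, IsNoetherianObject (M s)) {𝒞 : A → Prop} {X G : A} (ψ : X ⟶ G) [Mono ψ]
    (hpre : IsPreenvelope 𝒞 ψ)
    (hnull : ∀ δ : G ⟶ G, ψ ≫ δ = 0 →
      ∃ (I : A) (p : G ⟶ I) (q : I ⟶ G), Injective I ∧ p ≫ q = δ)
    (hsplit : ∀ (I : A) (i : I ⟶ G) (r : G ⟶ I), Injective I → i ≫ r = 𝟙 I →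
      ∃ (G₁ : A) (a : G₁ ⟶ G) (b : G ⟶ G₁), 𝒞 G₁ ∧ a ≫ b = 𝟙 G₁ ∧ b ≫ a = 𝟙 G - r ≫ i) :
    ∃ (G₁ : A) (ψ₁ : X ⟶ G₁), IsEnvelope 𝒞 ψ₁ := by
  obtain ⟨I, i, _, hi, hmax⟩ := exists_maximal_injective hM hN (cokernel.π ψ)
  have : Mono i := mono_of_mono i (cokernel.π ψ)
  let r : G ⟶ I := Injective.factorThru (𝟙 I) i
  have hir : i ≫ r = 𝟙 I := Injective.comp_factorThru _ _
  obtain ⟨G₁, a, b, hG₁, hab, hba⟩ := hsplit I i r inferInstance hir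
  have ha : Mono a := mono_of_mono_fac hab
  have hib : i ≫ b = 0 := by
    rw [← cancel_mono a, Category.assoc, hba, Preadditive.comp_sub, reassoc_of% hir]
    simp
  have hψ₁ : Mono (ψ ≫ b) := mono_of_comp_eq_zero fun W x hx => by
    have h1 : x ≫ ψ = x ≫ ψ ≫ r ≫ i := by
      have := hx =≫ a
      rw [Category.assoc, Category.assoc, hba, zero_comp, Preadditive.comp_sub,
        Preadditive.comp_sub, Category.comp_id] at this
      exact sub_eq_zero.1 this
    have h2 : x ≫ ψ ≫ r = 0 := by
      rw [← cancel_mono (i ≫ cokernel.π ψ), zero_comp]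
      have := h1 =≫ cokernel.π ψ
      simpa using this.symm
    rw [← cancel_mono ψ, h1, reassoc_of% h2, zero_comp, zero_comp]
  refine ⟨G₁, ψ ≫ b, ⟨hG₁, fun G' hG' f => ?_⟩, fun φ hφ => ?_⟩
  · obtain ⟨F, hF⟩ := hpre.2 G' hG' f
    let γ : G₁ ⟶ I := Injective.factorThru (ψ ≫ r) (ψ ≫ b)
    have hγ : (ψ ≫ b) ≫ γ = ψ ≫ r := Injective.comp_factorThru _ _
    refine ⟨a ≫ F + γ ≫ i ≫ F, ?_⟩
    simp only [Category.assoc] at hγ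
    rw [Preadditive.comp_add, Category.assoc, Category.assoc, reassoc_of% hγ, reassoc_of% hba]
    simp [Preadditive.sub_comp, Preadditive.comp_sub, hF]
  · have hred : IsReduced (ψ ≫ b) := fun J j hJ hj => by
      refine isZero_of_isIso_inl (hmax _ (biprod.desc i (j ≫ a)) inferInstance
        (mono_of_comp_eq_zero fun W x hx => ?_) biprod.inl (by simp))
      rw [← Category.assoc] at hx
      have hy := Abelian.monoLift_comp ψ (x ≫ biprod.desc i (j ≫ a)) hx
      have hdesc : biprod.desc i (j ≫ a) = biprod.fst ≫ i + biprod.snd ≫ j ≫ a := by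
        ext <;> simp
      have h2 : x ≫ biprod.snd = 0 := by
        rw [← cancel_mono (j ≫ cokernel.π (ψ ≫ b)), zero_comp]
        have := (hy =≫ b) =≫ cokernel.π (ψ ≫ b)
        simp only [Category.assoc, cokernel.condition, comp_zero, hdesc, Preadditive.add_comp,
          Preadditive.comp_add, hib, reassoc_of% hab, zero_add] at this
        simpa using this.symm
      have h1 : x ≫ biprod.fst = 0 := by
        rw [← cancel_mono (i ≫ cokernel.π ψ), zero_comp]
        simpa [hdesc, Preadditive.add_comp, Preadditive.comp_add, reassoc_of% h2] using hx
      ext <;> simp [h1, h2]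
    obtain ⟨I', p, q, _, hpq⟩ := hnull (b ≫ (φ - 𝟙 _) ≫ a) (by
      simp only [Category.assoc] at hφ
      simp [Preadditive.comp_sub, Preadditive.sub_comp, reassoc_of% hφ])
    refine isIso_of_factors_injective hred φ hφ (a ≫ p) (q ≫ b) ?_
    simp [reassoc_of% hpq, hab, reassoc_of% hab]

end Minimality

section Envelope

variable {A : Type w} [Category.{v} A] [Abelian A]

lemma homExact_of_projective {T : ChainComplex A ℤ} (hT : ∀ n, T.ExactAt n) (P : A)
    [Projective P] : HomExact T P := by
  rintro i j k hi hk f hf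
  have h := (exactAt_iff_exact T hi hk).1 (hT j)
  exact ⟨h.liftFromProjective f hf, h.liftFromProjective_comp f hf⟩

lemma homExact_iff_exactAt (T : ChainComplex A ℤ) (I : A) :
    HomExact T I ↔ ∀ n,
      (((preadditiveCoyoneda.obj (Opposite.op I)).mapHomologicalComplex _).obj T).ExactAt n := by
  have key : ∀ i j k : ℤ, j + 1 = i → k + 1 = j →
      ((((preadditiveCoyoneda.obj (Opposite.op I)).mapHomologicalComplex _).obj T).ExactAt j ↔
        ∀ f : I ⟶ T.X j, f ≫ T.d j k = 0 → ∃ g, g ≫ T.d i j = f) := fun i j k hi hk => by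
    rw [HomologicalComplex.exactAt_iff' _ i j k (by simp [← hi]) (by simp [← hk]),
      ShortComplex.ab_exact_iff]
    rfl
  constructor
  · intro h n
    exact (key (n + 1) n (n - 1) rfl (by omega)).2 (h _ _ _ rfl (by omega))
  · intro h i j k hi hk
    exact (key i j k hi hk).1 (h j)

lemma isGorensteinInjective_iff (G : A) : IsGorensteinInjective G ↔
    ∃ T : ChainComplex A ℤ, IsTotallyAcyclic T ∧ Nonempty (G ≅ kernel (T.d 0 (-1))) :=
  ⟨fun ⟨T, h₁, h₂, h₃, h₄⟩ => ⟨T, ⟨h₁, h₂, fun I hI => (homExact_iff_exactAt T I).2 (h₃ I hI)⟩, h₄⟩,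
    fun ⟨T, h, h'⟩ => ⟨T, h.injective, h.exactAt,
      fun I hI => (homExact_iff_exactAt T I).1 (h.homExact I hI), h'⟩⟩

/-- In a Grothendieck abelian category with a separating family of noetherian projective objects,
every object has a Gorenstein injective envelope. -/
theorem exists_gorensteinInjective_envelope [IsGrothendieckAbelian.{v} A]
    {σ : Type v} {M : σ → A} [∀ s, Projective (M s)]
    (hM : ∀ ⦃X Y : A⦄ (f : X ⟶ Y), (∀ s (m : M s ⟶ X), m ≫ f = 0) → f = 0)
    (hN : ∀ s, IsNoetherianObject (M s)) (X : A) :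
    ∃ (G : A) (ψ : X ⟶ G), IsEnvelope (fun K => IsGorensteinInjective K) ψ := by
  let N : σ ⊕ (Σ s, Subobject (M s)) → A :=
    Sum.elim M (fun x => Injective.under (cokernel x.2.arrow))
  have hN' : ∀ T : ChainComplex A ℤ, IsTotallyAcyclic T → ∀ t, HomExact T (N t) := by
    rintro T hT (s | x)
    · exact homExact_of_projective hT.exactAt (M s)
    · exact hT.homExact _ (inferInstanceAs (Injective (Injective.under _)))
  obtain ⟨T, g, hg, hgd, hinj, hhom, hT'⟩ := exists_homExact_complex N X
  have hT : IsTotallyAcyclic T := ⟨hinj, exactAt_of_homExact hM fun s => hhom (Sum.inl s),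
    homExact_of_injective hM hN fun s K => hhom (Sum.inr ⟨s, K⟩)⟩
  let ψ : X ⟶ kernel (T.d 0 (-1)) := kernel.lift _ g hgd
  have hψg : ψ ≫ kernel.ι _ = g := kernel.lift_ι _ _ _
  have : Mono ψ := mono_of_mono_fac hψg
  refine exists_isEnvelope hM hN ψ ⟨(isGorensteinInjective_iff _).2 ⟨T, hT, ⟨Iso.refl _⟩⟩,
    fun G' hG' f => ?_⟩ (fun δ hδ => ?_) (fun I i r hI hir => ?_)
  · obtain ⟨T', hT'', ⟨e⟩⟩ := (isGorensteinInjective_iff _).1 hG'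
    obtain ⟨h, hh⟩ := kernel_exists_hom ψ (T' := T') (by
      rw [hψg]
      exact (hT' T' hT''.injective (hN' T' hT'')).1) (f ≫ e.hom)
    exact ⟨h ≫ e.inv, by rw [reassoc_of% hh]; simp⟩
  · exact kernel_exists_factor hT hT ψ (by
      rw [hψg]
      exact (hT' T hT.injective (hN' T hT)).2) δ hδ
  · obtain ⟨T₁, a, b, hT₁, hab, hba⟩ := exists_complement hT i r hir
    exact ⟨_, a, b, (isGorensteinInjective_iff _).2 ⟨T₁, hT₁, ⟨Iso.refl _⟩⟩, hab, hba⟩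

end Envelope

section Disks

variable {A : Type w} [Category.{v} A] [Abelian A]

lemma projective_disk (P : A) [Projective P] (n : ℤ) :
    Projective (HomologicalComplex.double (𝟙 P) (rel_succ n)) := by
  refine ⟨fun {E X} f e he => ?_⟩
  have : Epi (e.f (n + 1)) :=
    inferInstanceAs (Epi ((HomologicalComplex.eval A (ComplexShape.down ℤ) (n + 1)).map e))
  have h := Projective.factorThru_comp
    ((HomologicalComplex.doubleXIso₀ (𝟙 P) (rel_succ n)).inv ≫ f.f (n + 1)) (e.f (n + 1))
  set x := Projective.factorThru
    ((HomologicalComplex.doubleXIso₀ (𝟙 P) (rel_succ n)).inv ≫ f.f (n + 1)) (e.f (n + 1))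
  have h' := h =≫ X.d (n + 1) n
  simp only [Category.assoc, HomologicalComplex.Hom.comm] at h'
  refine ⟨HomologicalComplex.mkHomFromDouble _ (succ_ne n) x (x ≫ E.d _ _) (by simp)
    (by simp), ?_⟩
  ext
  · simp [h]
  · simp [h', HomologicalComplex.double_d _ _ (succ_ne n)]

lemma eq_zero_of_disk_comp {σ : Type*} (M : σ → A)
    (hM : ∀ ⦃X Y : A⦄ (f : X ⟶ Y), (∀ s (m : M s ⟶ X), m ≫ f = 0) → f = 0)
    {X Y : ChainComplex A ℤ} (f : X ⟶ Y)
    (hf : ∀ s n (m : HomologicalComplex.double (𝟙 (M s)) (rel_succ n) ⟶ X), m ≫ f = 0) :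
    f = 0 := by
  ext n
  obtain ⟨n, rfl⟩ : ∃ m, n = m + 1 := ⟨n - 1, by omega⟩
  refine hM _ fun s m => ?_
  have h := congrArg (fun φ => HomologicalComplex.Hom.f φ (n + 1))
    (hf s n (HomologicalComplex.mkHomFromDouble _ (succ_ne n) m (m ≫ X.d _ _) (by simp) (by simp)))
  rw [← cancel_epi (HomologicalComplex.doubleXIso₀ (𝟙 (M s)) (rel_succ n)).hom]
  simpa using h

lemma isNoetherianObject_disk (M : A) [IsNoetherianObject M] (n : ℤ) :
    IsNoetherianObject (HomologicalComplex.double (𝟙 M) (rel_succ n)) := by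
  set D := HomologicalComplex.double (𝟙 M) (rel_succ n) with hD
  rw [isNoetherianObject_iff_monotone_chain_condition]
  intro f
  have hmono : ∀ m k, Mono ((f m).arrow.f k) := fun m k =>
    inferInstanceAs (Mono ((HomologicalComplex.eval A (ComplexShape.down ℤ) k).map (f m).arrow))
  have hstab : ∀ k, IsNoetherianObject (D.X k) → ∃ N, ∀ m, N ≤ m →
      Subobject.mk ((f N).arrow.f k) = Subobject.mk ((f m).arrow.f k) := fun k hk =>
    monotone_chain_condition_of_isNoetherianObject
      ⟨fun m => Subobject.mk ((f m).arrow.f k), fun a b hab =>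
        Subobject.mk_le_mk_of_comm ((Subobject.ofLE _ _ (f.monotone hab)).f k) (by
          rw [← HomologicalComplex.comp_f, Subobject.ofLE_arrow])⟩
  obtain ⟨N₀, h₀⟩ := hstab (n + 1)
    (isNoetherianObject_of_mono (HomologicalComplex.doubleXIso₀ (𝟙 M) (rel_succ n)).hom)
  obtain ⟨N₁, h₁⟩ := hstab n
    (isNoetherianObject_of_mono (HomologicalComplex.doubleXIso₁ (𝟙 M) (rel_succ n) (succ_ne n)).hom)
  refine ⟨max N₀ N₁, fun m hm => le_antisymm (f.monotone hm) ?_⟩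
  have hk : ∀ k, Subobject.mk ((f m).arrow.f k) ≤ Subobject.mk ((f (max N₀ N₁)).arrow.f k) := by
    intro k
    by_cases hk₀ : k = n + 1
    · subst hk₀
      rw [← h₀ _ (le_max_left _ _), ← h₀ _ ((le_max_left _ _).trans hm)]
    by_cases hk₁ : k = n
    · subst hk₁
      rw [← h₁ _ (le_max_right _ _), ← h₁ _ ((le_max_right _ _).trans hm)]
    · have := Subobject.subsingleton_of_isZero
        (HomologicalComplex.isZero_double_X (𝟙 M) (rel_succ n) k hk₀ hk₁)
      exact (Subsingleton.elim _ _).le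
  set Φ := Subobject.ofLE _ _ (f.monotone hm)
  have hΦ : Φ ≫ (f m).arrow = (f (max N₀ N₁)).arrow := Subobject.ofLE_arrow _
  have hΦk : ∀ k, Φ.f k ≫ (f m).arrow.f k = (f (max N₀ N₁)).arrow.f k := fun k => by
    rw [← HomologicalComplex.comp_f, hΦ]
  have : ∀ k, IsIso (Φ.f k) := fun k => by
    have ht := Subobject.ofMkLEMk_comp (hk k)
    refine ⟨Subobject.ofMkLEMk _ _ (hk k), ?_, ?_⟩
    · rw [← cancel_mono ((f (max N₀ N₁)).arrow.f k), Category.assoc, ht, hΦk, Category.id_comp]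
    · rw [← cancel_mono ((f m).arrow.f k), Category.assoc, hΦk, ht, Category.id_comp]
  have : IsIso Φ := HomologicalComplex.Hom.isIso_of_components Φ
  exact Subobject.le_of_comm (inv Φ) (by simp [← hΦ])

end Disks

section Modules

lemma isNoetherianObject_moduleCat (R : Type u) [CommRing R] [IsNoetherianRing R] :
    IsNoetherianObject (ModuleCat.of R R) := by
  rw [isNoetherianObject_iff_not_strictMono]
  intro f hf
  exact not_strictMono_of_wellFoundedGT (fun n => ModuleCat.subobjectModule _ (f n))
    ((ModuleCat.subobjectModule _).strictMono.comp hf)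

end Modules

end GorensteinEnvelope

/-- If `R` is a commutative noetherian ring with a dualizing complex, then
every (unbounded) complex of `R`-modules has a Gorenstein injective envelope. -/
theorem gorensteinInjective_complexes_enveloping_of_dualizingComplex
    (R : Type u) [CommRing R] [IsNoetherianRing R]
    (hD : ∃ D : CochainComplex (ModuleCat.{u} R) ℤ, IsDualizingComplex R D) :
    ∀ X : ChainComplex (ModuleCat.{u} R) ℤ, ∃ (G : ChainComplex (ModuleCat.{u} R) ℤ)
      (ψ : X ⟶ G), IsEnvelope (fun K => IsGorensteinInjective K) ψ := by
  have := GorensteinEnvelope.isNoetherianObject_moduleCat R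
  have : Projective (ModuleCat.of R R) :=
    (IsProjective.iff_projective (R := R) R).1 inferInstance
  have hproj (n : ULift.{u} ℤ) := GorensteinEnvelope.projective_disk (ModuleCat.of R R) n.down
  refine GorensteinEnvelope.exists_gorensteinInjective_envelope
    (M := fun n : ULift.{u} ℤ =>
      HomologicalComplex.double (𝟙 (ModuleCat.of R R)) (GorensteinEnvelope.rel_succ n.down))
    (fun X Y f hf => ?_)
    (fun n => GorensteinEnvelope.isNoetherianObject_disk (ModuleCat.of R R) n.down)
  refine GorensteinEnvelope.eq_zero_of_disk_comp (fun _ : Unit => ModuleCat.of R R)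
    (fun X Y g hg => ?_) f (fun _ n => hf ⟨n⟩)
  ext x
  have := hg () (ModuleCat.ofHom (LinearMap.toSpanSingleton R X x))
  simpa using congrArg (fun φ => φ.hom (1 : R)) this
end
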